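/- Architecture. Fix a depth $L\ge 1$, integers $U_l,w_l$ ($0\le l\le L$) with $w_L=1$ and $K:=U_L\ge 2$, integers $m_l,d_l,O_{l-1}$ ($1\le l\le L$), ordered sets $S^{l-1,o}$ ($o\le O_{l-1}$) of $d_l$ distinct coordinates of $\mathbb{R}^{U_{l-1}\times w_{l-1}}$ (the convolutional patches), and nonlinearities $G_l:\mathbb{R}^{m_l\times O_{l-1}}\to\mathbb{R}^{U_l\times w_l}$ that are $\rho_l$-Lipschitz with respect to the $\ell^\infty$ norms and satisfy $G_l(0)=0$. For $A^l\in\mathbb{R}^{m_l\times d_l}$ put $\Lambda_{A^l}(x)_{j,o}=\sum_{i=1}^{d_l}x_{S^{l-1,o}_i}(A^l)_{j,i}$, and for $\mathcal{A}=(A^1,\dots,A^L)$ put $F_{\mathcal{A}}=G_L\circ\Lambda_{A^L}\circ\cdots\circ G_1\circ\Lambda_{A^1}:\mathbb{R}^{U_0\times w_0}\to\mathbb{R}^{K}$. Let $\bar W=\max_{1\le l\le L}O_{l-1}m_l$ and let $M^l\in\mathbb{R}^{m_l\times d_l}$ be fixed reference matrices. Norms. On $\mathbb{R}^{U_l\times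 w_l}$ let $|x|_\infty$ be the $\ell^\infty$ norm, $|x|_{\infty,l}$ the maximum over spatial positions of the Euclidean norm across channels, and, for $l<L$, $|x|_l$ the maximum Euclidean norm of a convolutional patch; for the output layer let $|x|_L=|x|_\infty$. Let $|\cdot|_{\mathcal{L}_l}$ ($0\le l\le L$) be norms on the activation spaces and $\|\cdot\|_{\mathcal{L}_l^*}$ ($1\le l\le L$) norms on the weight spaces such that $|\cdot|_l\le|\cdot|_{\mathcal{L}_l}$ for $0\le l\le L$, and such that for every $A^l$ the Lipschitz constant of $G_l\circ\Lambda_{A^l}$ with respect to $|\cdot|_{\mathcal{L}_{l-1}}$ and $|\cdot|_{\mathcal{L}_l}$ is at most $\|A^l\|_{\mathcal{L}_l^*}$. Let $k_l$ be constants with $|\cdot|_{\mathcal{L}_l}\le\sqrt{k_l}\,|\cdot|_\infty$ for $1\le l\le L$. Write $\|B^\top\|_{2,1}$ for the sum of the Euclidean norms of the rows of $B$ and $\|B\|_{\mathrm{Fr}}$ for the Frobenius norm. Claim. Let $(x_1,y_1),\dots,(x_n,y_n)$, $n\ge1$, be i.i.d. observations from a probability distribution on $\mathbb{R}^{U_0\times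 w_0}\times\{1,\dots,K\}$, and let $(x,y)$ be a further independent observation. For every $\delta>0$, with probability at least $1-\delta$ over the sample, every $\mathcal{A}=(A^1,\dots,A^L)$ and every $\gamma>0$ satisfy $$\begin{aligned}\mathbb{P}\Big(\operatorname*{arg\,max}_jF_{\mathcal{A}}(x)_j\ne y\Big)\le{}&\frac{n-\#I}{n}+\frac8n+\frac{1536}{\sqrt n}R_{\mathcal{A}}\big[\log_2(32\Gamma n^2+7\bar Wn)\big]^{1/2}\log n+3\sqrt{\frac{\log(2/\delta)}{2n}}+\sqrt{\max\Big(0,\log\frac{2}{\gamma n}\Big)}\\&+3\sqrt{\frac1n\sum_{l=1}^L\Big[\log\Big(2+\sup_i|x_i|_{\mathcal{L}_0}\Big)+\log\Big(2+\tfrac{\|(A^l-M^l)^\top\|_{2,1}}{L}\Big)+\log\Big(2+\tfrac{\|A^l\|_{\mathcal{L}_l^*}}{L}\Big)\Big]},\end{aligned}$$ where the probability on the left is over $(x,y)$ and ties of the maximal score count as errors, $I=\{i\le n:F_{\mathcal{A}}(x_i)_{y_i}-\max_{j\ne y_i}F_{\mathcal{A}}(x_i)_j>\gamma\}$, $$R_{\mathcal{A}}=\frac1\gamma\,L\Big(\sup_i|x_i|_{\mathcal{L}_0}+1\Big)\Big[\sum_{l=1}^L\Big(\big(\|A^l-M^l\|_{\mathrm{Fr}}+\tfrac1L\big)\rho_l\sqrt{k_l}\prod_{i\ne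 l}\big(\|A^i\|_{\mathcal{L}_i^*}+\tfrac1L\big)\Big)^2\Big]^{1/2},$$ $$\Gamma=\Big(\sup_i|x_i|_{\mathcal{L}_0}+1\Big)\max_{1\le l\le L}\Big(O_{l-1}m_l\big(\|(A^l-M^l)^\top\|_{2,1}+\tfrac1L\big)\prod_{i\ne l}\big(\|A^i\|_{\mathcal{L}_i^*}+\tfrac1L\big)\Big).$$ Moreover, let $\kappa_l$ be constants with $|\cdot|_{\mathcal{L}_l}\le\sqrt{\kappa_l}\,|\cdot|_{\infty,l}$ for $1\le l\le L$, and suppose that each $G_l$ is also $\rho_l$-Lipschitz with respect to the norms "maximum over spatial positions of the Euclidean norm across channels" on $\mathbb{R}^{m_l\times O_{l-1}}$ and $\mathbb{R}^{U_l\times w_l}$ (as for an elementwise ReLU followed by purely spatial max pooling, with $\rho_l=1$). Then the same statement holds with $R_{\mathcal{A}}$ replaced by $$\frac1\gamma\Big(\sup_i|x_i|_{\mathcal{L}_0}+1\Big)\Big[\sum_{l=1}^L\Big(\big(\|(A^l-M^l)^\top\|_{2,1}+\tfrac1L\big)\rho_l\sqrt{\kappa_l}\prod_{i\ne l}\big(\|A^i\|_{\mathcal{L}_i^*}+\tfrac1L\big)\Big)^{2/3}\Big]^{3/2}.$$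 -/

import Mathlib

open MeasureTheory
open scoped NNReal

/-- A convolutional feedforward architecture of depth `L`.

The layer-`l` activation space (`l = 0, …, L`) is `ℝ^{U l × w l}` (channels × spatial positions),
`O l` is the number of convolutional patches of layer `l`, and `patch l o` is the `o`-th of them,
an ordered set of `d (l + 1)` distinct coordinates.  `m (l + 1)` is the number of filters applied
to layer `l`, and `G l` is the nonlinearity (activation and pooling) that turns the resulting
preactivations into the activations of layer `l + 1`.  The last layer has one spatial position and
`K = U L` channels, the class scores.  Only the entries of these families up to depth `L` matter. -/
structure ConvNet where
  L : ℕ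
  L_pos : 0 < L
  U : ℕ → ℕ
  w : ℕ → ℕ
  m : ℕ → ℕ
  d : ℕ → ℕ
  O : ℕ → ℕ
  patch : (l : ℕ) → Fin (O l) → Fin (d (l + 1)) ↪ Fin (U l) × Fin (w l)
  G : (l : ℕ) → (Fin (m (l + 1)) → Fin (O l) → ℝ) → (Fin (U (l + 1)) → Fin (w (l + 1)) → ℝ)
  w_last : w L = 1

namespace ConvNet

variable (net : ConvNet)

/-- The layer-`l` activation space.  Its Mathlib norm `‖x‖` is the `ℓ^∞` norm. -/
abbrev Act (l : ℕ) : Type := Fin (net.U l) → Fin (net.w l) → ℝ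

/-- The preactivations computed from layer `l`.  The Mathlib norm is the `ℓ^∞` norm. -/
abbrev PreAct (l : ℕ) : Type := Fin (net.m (l + 1)) → Fin (net.O l) → ℝ

/-- The space of filter matrices from layer `l` to layer `l + 1`; each row is a filter. -/
abbrev Wt (l : ℕ) : Type := Matrix (Fin (net.m (l + 1))) (Fin (net.d (l + 1))) ℝ

/-- The number of classes. -/
abbrev K : ℕ := net.U net.L

/-- The convolution `Λ_A`. -/
def conv (l : ℕ) (A : net.Wt l) (x : net.Act l) : net.PreAct l :=
  fun j o => ∑ i, x (net.patch l o i).1 (net.patch l o i).2 * A j i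

/-- One full layer, `G ∘ Λ_A`. -/
def layer (l : ℕ) (A : net.Wt l) (x : net.Act l) : net.Act (l + 1) :=
  net.G l (net.conv l A x)

/-- The activations of layer `l` as a function of the input. -/
def F (A : ∀ l, net.Wt l) : (l : ℕ) → net.Act 0 → net.Act l
  | 0 => id
  | l + 1 => fun x => net.layer l (A l) (F A l x)

/-- `|x|_l`: the maximum Euclidean norm of a convolutional patch of `x`. -/
noncomputable def patchNorm (l : ℕ) (x : net.Act l) : ℝ :=
  ⨆ o : Fin (net.O l), Real.sqrt (∑ i, (x (net.patch l o i).1 (net.patch l o i).2) ^ 2)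

/-- `‖(A − M)^⊤‖_{2,1}`: the sum of the Euclidean norms of the rows of `A − M`. -/
noncomputable def dist21 (l : ℕ) (A M : net.Wt l) : ℝ :=
  ∑ j, Real.sqrt (∑ i, (A j i - M j i) ^ 2)

/-- `‖A − M‖_Fr`. -/
noncomputable def distFr (l : ℕ) (A M : net.Wt l) : ℝ :=
  Real.sqrt (∑ j, ∑ i, (A j i - M j i) ^ 2)

/-- The class score `F_𝒜(x)_c`. -/
def score (A : ∀ l, net.Wt l) (x : net.Act 0) (c : Fin net.K) : ℝ :=
  net.F A net.L x c ⟨0, by rw [net.w_last]; exact Nat.one_pos⟩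

/-- The margin `F_𝒜(x)_y − max_{j ≠ y} F_𝒜(x)_j`. -/
noncomputable def margin (A : ∀ l, net.Wt l) (x : net.Act 0) (y : Fin net.K) : ℝ :=
  net.score A x y - ⨆ c : {c : Fin net.K // c ≠ y}, net.score A x c

/-- The misclassification event; a tie with another class counts as an error. -/
def errorSet (A : ∀ l, net.Wt l) : Set (net.Act 0 × Fin net.K) :=
  {p | ∃ c, c ≠ p.2 ∧ net.score A p.1 p.2 ≤ net.score A p.1 c}

/-- `W̄ = max_l O_{l-1} m_l`. -/
noncomputable def preWidth : ℝ :=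
  ⨆ l : Fin net.L, (net.O l : ℝ) * (net.m ((l : ℕ) + 1) : ℝ)

variable (normA : ∀ l, Seminorm ℝ (net.Act l)) (normW : ∀ l, Seminorm ℝ (net.Wt l))

/-- `∏_{i ≠ l} (‖A^i‖_{𝓛_i*} + 1/L)`. -/
noncomputable def prodExcept (A : ∀ l, net.Wt l) (l : ℕ) : ℝ :=
  ∏ i ∈ (Finset.range net.L).erase l, (normW i (A i) + 1 / (net.L : ℝ))

/-- `sup_i ‖x_i‖_{𝓛_0}` over the sample. -/
noncomputable def sampleNorm {n : ℕ} (s : Fin n → net.Act 0 × Fin net.K) : ℝ :=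
  ⨆ i : Fin n, normA 0 (s i).1

/-- The capacity `R_𝒜` with Frobenius norms. -/
noncomputable def capFr (ρ : ℕ → ℝ≥0) (k : ℕ → ℝ) (M : ∀ l, net.Wt l) {n : ℕ}
    (s : Fin n → net.Act 0 × Fin net.K) (A : ∀ l, net.Wt l) (γ : ℝ) : ℝ :=
  1 / γ * net.L * (net.sampleNorm normA s + 1) *
    Real.sqrt (∑ l ∈ Finset.range net.L,
      ((net.distFr l (A l) (M l) + 1 / (net.L : ℝ)) * (ρ (l + 1) * Real.sqrt (k (l + 1))) *
        net.prodExcept normW A l) ^ 2)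

/-- The capacity `R_𝒜` with `(2,1)` norms. -/
noncomputable def cap21 (ρ : ℕ → ℝ≥0) (κ : ℕ → ℝ) (M : ∀ l, net.Wt l) {n : ℕ}
    (s : Fin n → net.Act 0 × Fin net.K) (A : ∀ l, net.Wt l) (γ : ℝ) : ℝ :=
  1 / γ * (net.sampleNorm normA s + 1) *
    (∑ l ∈ Finset.range net.L,
      ((net.dist21 l (A l) (M l) + 1 / (net.L : ℝ)) * (ρ (l + 1) * Real.sqrt (κ (l + 1))) *
        net.prodExcept normW A l) ^ ((2 : ℝ) / 3)) ^ ((3 : ℝ) / 2)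

/-- `Γ`. -/
noncomputable def gam (M : ∀ l, net.Wt l) {n : ℕ}
    (s : Fin n → net.Act 0 × Fin net.K) (A : ∀ l, net.Wt l) : ℝ :=
  (net.sampleNorm normA s + 1) *
    ⨆ l : Fin net.L, (net.O l : ℝ) * (net.m ((l : ℕ) + 1) : ℝ) *
      (net.dist21 l (A l) (M l) + 1 / (net.L : ℝ)) * net.prodExcept normW A l

/-- The right-hand side of the generalisation bound, for a given capacity `R`.  Since `Real.sqrt`
vanishes on negative numbers, `√(log (2/(γn)))` is `0` as soon as `γ ≥ 2/n`. -/
noncomputable def riskBound (M : ∀ l, net.Wt l) {n : ℕ}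
    (s : Fin n → net.Act 0 × Fin net.K) (A : ∀ l, net.Wt l) (γ δ R : ℝ) : ℝ :=
  ((n : ℝ) - (Nat.card {i : Fin n // γ < net.margin A (s i).1 (s i).2} : ℝ)) / n +
    8 / n +
    1536 / Real.sqrt n * R *
      Real.sqrt (Real.logb 2
        (32 * net.gam normA normW M s A * (n : ℝ) ^ 2 + 7 * net.preWidth * n)) *
      Real.log n +
    3 * Real.sqrt (Real.log (2 / δ) / (2 * n)) +
    Real.sqrt (Real.log (2 / (γ * n))) +
    3 * Real.sqrt (1 / n * ∑ l ∈ Finset.range net.L,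
      (Real.log (2 + net.sampleNorm normA s) +
        Real.log (2 + net.dist21 l (A l) (M l) / net.L) +
        Real.log (2 + normW l (A l) / net.L)))

end ConvNet

/-- The maximum over spatial positions of the Euclidean norm across channels; on activations of
layer `l` this is `|x|_{∞,l}`. -/
noncomputable def pixelNorm {a b : ℕ} (x : Fin a → Fin b → ℝ) : ℝ :=
  ⨆ j : Fin b, Real.sqrt (∑ u, (x u j) ^ 2)

/-! ### Sub-probability weights -/

/-- A nonnegative weight whose finite sums are at most one. -/
def SubProb {α : Type*} (w : α → ℝ) : Prop :=
  (∀ a, 0 ≤ w a) ∧ ∀ S : Finset α, ∑ a ∈ S, w a ≤ 1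

/-! ### Tails of signed sums -/

/-- The sign attached to a Boolean. -/
def boolSign (b : Bool) : ℝ := if b then -1 else 1

theorem sum_exp_boolSign (n : ℕ) (a : Fin n → ℝ) :
    ∑ σ : Fin n → Bool, Real.exp (∑ k, boolSign (σ k) * a k) = ∏ k, (2 * Real.cosh (a k)) := by
  simp_rw [Real.exp_sum]
  rw [← Fintype.prod_sum (fun k b => Real.exp (boolSign b * a k))]
  refine Finset.prod_congr rfl fun k _ => ?_
  simp [boolSign, Real.cosh_eq]
  ring

theorem card_signed_sum_gt_le {n : ℕ} (hn : 0 < n) (a : Fin n → ℝ) (ha : ∀ k, |a k| ≤ 1) {v : ℝ}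
    (hv : 0 ≤ v) :
    ((Finset.univ.filter fun σ : Fin n → Bool => v < ∑ k, boolSign (σ k) * a k).card : ℝ) ≤
      2 ^ n * Real.exp (-(v ^ 2 / (2 * n))) := by
  have hn' : (0 : ℝ) < n := Nat.cast_pos.2 hn
  set lam : ℝ := v / n with hlam
  have hl : 0 ≤ lam := by positivity
  have h1 : ((Finset.univ.filter fun σ : Fin n → Bool => v < ∑ k, boolSign (σ k) * a k).card : ℝ)
      * Real.exp (lam * v) ≤ ∑ σ : Fin n → Bool, Real.exp (∑ k, boolSign (σ k) * (lam * a k)) := by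
    rw [← nsmul_eq_mul, ← Finset.sum_const]
    refine (Finset.sum_le_sum (fun σ hσ => ?_)).trans
      (Finset.sum_le_sum_of_subset_of_nonneg (Finset.subset_univ _) fun _ _ _ => (Real.exp_pos _).le)
    rw [Finset.mem_filter] at hσ
    refine Real.exp_le_exp.2 ?_
    have : ∑ k, boolSign (σ k) * (lam * a k) = lam * ∑ k, boolSign (σ k) * a k := by
      rw [Finset.mul_sum]
      exact Finset.sum_congr rfl fun _ _ => by ring
    rw [this]
    exact mul_le_mul_of_nonneg_left hσ.2.le hl
  have h2 : ∏ k, (2 * Real.cosh (lam * a k)) ≤ 2 ^ n * Real.exp (n * (lam ^ 2 / 2)) := by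
    have : ∏ _k : Fin n, (2 * Real.exp (lam ^ 2 / 2)) = 2 ^ n * Real.exp (n * (lam ^ 2 / 2)) := by
      rw [Finset.prod_const, Finset.card_univ, Fintype.card_fin, mul_pow, ← Real.exp_nat_mul]
    rw [← this]
    refine Finset.prod_le_prod (fun k _ => by positivity) fun k _ => ?_
    refine mul_le_mul_of_nonneg_left ((Real.cosh_le_exp_half_sq _).trans ?_) two_pos.le
    refine Real.exp_le_exp.2 ?_
    have := (sq_le_one_iff_abs_le_one (a k)).2 (ha k)
    rw [mul_pow]
    nlinarith [sq_nonneg lam]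
  rw [sum_exp_boolSign] at h1
  have h3 := h1.trans h2
  have h4 : 2 ^ n * Real.exp (-(v ^ 2 / (2 * n))) * Real.exp (lam * v) =
      2 ^ n * Real.exp (n * (lam ^ 2 / 2)) := by
    rw [mul_assoc, ← Real.exp_add]
    congr 2
    rw [hlam]; field_simp; ring
  rw [← h4] at h3
  exact le_of_mul_le_mul_right h3 (Real.exp_pos _)

/-! ### One-sided Chebyshev inequality for empirical frequencies -/

theorem half_le_measure_freq {Z : Type*} [MeasurableSpace Z] (μ : Measure Z) [IsProbabilityMeasure μ]
    {n : ℕ} (hn : 0 < n) {E : Set Z} (hE : MeasurableSet E) :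
    (1 / 2 : ENNReal) ≤ (Measure.pi fun _ : Fin n => μ)
      {s | n * μ.real E - Real.sqrt n / 2 ≤ ∑ k, E.indicator (fun _ => (1 : ℝ)) (s k)} := by
  classical
  have hn' : (0 : ℝ) < n := Nat.cast_pos.2 hn
  set P := Measure.pi fun _ : Fin n => μ with hP
  set X : Z → ℝ := E.indicator fun _ => (1 : ℝ) with hX
  have hXm : Measurable X := measurable_const.indicator hE
  have hXb : ∀ z, X z ∈ Set.Icc (0 : ℝ) 1 := fun z => by
    by_cases h : z ∈ E <;> simp [hX, h]
  have hXL : MemLp X 2 μ := by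
    refine MemLp.of_bound hXm.aestronglyMeasurable 1 (Filter.Eventually.of_forall fun z => ?_)
    rw [Real.norm_eq_abs, abs_of_nonneg (hXb z).1]; exact (hXb z).2
  set Y : (Fin n → Z) → ℝ := ∑ k, fun s => X (s k) with hY
  have hYapp : ∀ s, Y s = ∑ k, X (s k) := fun s => by simp [hY]
  have hYL : MemLp Y 2 P := by
    refine memLp_finsetSum' _ fun k _ => ?_
    exact hXL.comp_measurePreserving (measurePreserving_eval (fun _ : Fin n => μ) k)
  have hvar : ProbabilityTheory.variance Y P ≤ n / 4 := by
    rw [hY, hP, ProbabilityTheory.variance_sum_pi (X := fun _ : Fin n => X) fun _ => hXL]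
    calc _ ≤ ∑ _k : Fin n, ((1 - 0) / 2 : ℝ) ^ 2 := Finset.sum_le_sum fun k _ =>
          ProbabilityTheory.variance_le_sq_of_bounded (Filter.Eventually.of_forall hXb)
            hXm.aemeasurable
      _ = n / 4 := by simp; ring
  have hmean : ∫ s, Y s ∂P = n * μ.real E := by
    simp_rw [hYapp]
    rw [integral_finsetSum]
    · have : ∀ k : Fin n, ∫ s, X (s k) ∂P = μ.real E := fun k => by
        have h := (measurePreserving_eval (fun _ : Fin n => μ) k)
        have h2 := integral_map (μ := P) h.measurable.aemeasurable
          (f := X) hXm.aestronglyMeasurable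
        rw [h.map_eq] at h2
        change ∫ s, X (Function.eval k s) ∂P = _
        rw [← h2, hX, integral_indicator_const _ hE]; simp
      simp [this]
    · intro k _
      exact (hXL.comp_measurePreserving (measurePreserving_eval (fun _ : Fin n => μ) k)).integrable
        (by norm_num)
  set t : ℝ := Real.sqrt n / 2 with ht
  have ht2 : t ^ 2 = n / 4 := by rw [ht, div_pow, Real.sq_sqrt hn'.le]; norm_num
  have htp : 0 < t := by positivity
  have hYi : Integrable Y P := hYL.integrable (by norm_num)
  set c := ∫ s, Y s ∂P with hc
  have hcen : Integrable (fun s => (Y s - c) ^ 2) P :=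
    ((hYL.sub (memLp_const c)).integrable_sq)
  have hsq : ∫ s, (Y s - c - t) ^ 2 ∂P ≤ 2 * t ^ 2 := by
    have e1 : ∀ s, (Y s - c - t) ^ 2 = (Y s - c) ^ 2 + ((-2 * t) * (Y s - c) + t ^ 2) := fun s => by
      ring
    simp_rw [e1]
    rw [integral_add hcen (by fun_prop), integral_add (by fun_prop) (by fun_prop),
      integral_const_mul, integral_sub hYi (by fun_prop),
      ← ProbabilityTheory.variance_eq_integral hYi.aemeasurable]
    simp only [integral_const, probReal_univ, one_smul, ← hc, sub_self, mul_zero, zero_add]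
    rw [ht2]; linarith
  have hint : Integrable (fun s => (Y s - c - t) ^ 2) P :=
    ((hYL.sub (memLp_const c)).sub (memLp_const t)).integrable_sq
  have hmarkov := mul_meas_ge_le_integral_of_nonneg
    (Filter.Eventually.of_forall fun s => sq_nonneg (Y s - c - t)) hint (4 * t ^ 2)
  have hbad : P.real {s | 4 * t ^ 2 ≤ (Y s - c - t) ^ 2} ≤ 1 / 2 := by
    have := hmarkov.trans hsq
    have h4 : 0 < t ^ 2 := by positivity
    nlinarith
  have hYm : Measurable Y := by
    have : Y = fun s => ∑ k, X (s k) := funext hYapp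
    rw [this]; fun_prop
  have hm : MeasurableSet {s : Fin n → Z | n * μ.real E - t ≤ ∑ k, X (s k)} := by
    simp_rw [← hYapp]; exact measurableSet_le measurable_const hYm
  have hcompl : P.real {s : Fin n → Z | n * μ.real E - t ≤ ∑ k, X (s k)}ᶜ ≤ 1 / 2 := by
    refine (measureReal_mono ?_).trans hbad
    intro s hs
    simp only [Set.mem_compl_iff, Set.mem_ofPred_eq, not_le, ← hYapp, ← hmean] at hs ⊢
    nlinarith
  rw [probReal_compl_eq_one_sub hm] at hcompl
  have : (1 / 2 : ENNReal) = ENNReal.ofReal (1 / 2) := by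
    rw [ENNReal.ofReal_div_of_pos two_pos]; simp
  rw [this]
  refine (ENNReal.ofReal_le_ofReal (by linarith)).trans_eq
    (ofReal_measureReal (μ := P) (s := {s : Fin n → Z | n * μ.real E - t ≤ ∑ k, X (s k)}))

/-! ### Symmetrisation with a weighted union bound -/

/-- The points of a double sample: `false` selects the training copy, `true` the ghost copy. -/
def samplePt {Z : Type*} {n : ℕ} (z : Fin n → Z × Z) (p : Fin n × Bool) : Z :=
  if p.2 then (z p.1).2 else (z p.1).1

/-- The code `c` describes, on the double sample `z`, a set of points that contains those in `E`
and avoids those in `V`. -/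
def Separates {Z C : Type*} {n : ℕ} (h : (Fin n → Z × Z) → C → Set (Fin n × Bool))
    (z : Fin n → Z × Z) (c : C) (E V : Set Z) : Prop :=
  ∀ p, (samplePt z p ∈ E → p ∈ h z c) ∧ (samplePt z p ∈ V → p ∉ h z c)

/-- On every double sample, the pair `(E, V)` is separated by a code of cost at most `b`. -/
def Describable {Z C : Type*} {n : ℕ} (h : (Fin n → Z × Z) → C → Set (Fin n × Bool)) (w : C → ℝ)
    (E V : Set Z) (b : ℝ) : Prop :=
  ∀ z, ∃ c, Separates h z c E V ∧ Real.exp (-b) ≤ w c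

/-- The deviation allowed to a pair of description cost `b`. -/
noncomputable def deviation (n : ℕ) (δ b : ℝ) : ℝ :=
  Real.sqrt (2 * (b + Real.log (2 / δ)) / n)

/-- The double samples on which some describable pair deviates. -/
def deviationSet {Z C : Type*} [TopologicalSpace Z] {n : ℕ}
    (h : (Fin n → Z × Z) → C → Set (Fin n × Bool)) (w : C → ℝ) (δ : ℝ) : Set (Fin n → Z × Z) :=
  {z | ∃ (E V : Set Z) (b : ℝ), IsOpen E ∧ IsOpen V ∧ 0 ≤ b ∧ Describable h w E V b ∧
    n * deviation n δ b + n < ∑ k, (E.indicator (fun _ => (1 : ℝ)) (z k).2 +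
      V.indicator (fun _ => (1 : ℝ)) (z k).1)}

theorem isOpen_deviationSet {Z C : Type*} [TopologicalSpace Z] {n : ℕ}
    (h : (Fin n → Z × Z) → C → Set (Fin n × Bool)) (w : C → ℝ) (δ : ℝ) :
    IsOpen (deviationSet h w δ) := by
  have : deviationSet h w δ = ⋃ (E : Set Z) (V : Set Z) (b : ℝ) (_ : IsOpen E) (_ : IsOpen V)
      (_ : 0 ≤ b) (_ : Describable h w E V b),
      {z | n * deviation n δ b + n < ∑ k, (E.indicator (fun _ => (1 : ℝ)) (z k).2 +
        V.indicator (fun _ => (1 : ℝ)) (z k).1)} := by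
    ext z
    simp only [deviationSet, Set.mem_ofPred_eq, Set.mem_iUnion, exists_prop]
  rw [this]
  refine isOpen_iUnion fun E => isOpen_iUnion fun V => isOpen_iUnion fun b => isOpen_iUnion fun hE =>
    isOpen_iUnion fun hV => isOpen_iUnion fun _ => isOpen_iUnion fun _ => ?_
  have hls : LowerSemicontinuous fun z : Fin n → Z × Z =>
      ∑ k, (E.indicator (fun _ => (1 : ℝ)) (z k).2 + V.indicator (fun _ => (1 : ℝ)) (z k).1) := by
    refine lowerSemicontinuous_sum fun k _ => LowerSemicontinuous.add ?_ ?_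
    · exact (hE.lowerSemicontinuous_indicator zero_le_one).comp (g := fun z : Fin n → Z × Z => (z k).2) (by fun_prop)
    · exact (hV.lowerSemicontinuous_indicator zero_le_one).comp (g := fun z : Fin n → Z × Z => (z k).1) (by fun_prop)
  exact hls.isOpen_preimage _

/-- Exchange the two copies at the indices selected by `σ`. -/
def swapAt {Z : Type*} {n : ℕ} (σ : Fin n → Bool) (z : Fin n → Z × Z) : Fin n → Z × Z :=
  fun k => if σ k then (z k).swap else z k

theorem measurePreserving_swapAt {Z : Type*} [MeasurableSpace Z] (μ : Measure Z)
    [IsProbabilityMeasure μ] {n : ℕ} (σ : Fin n → Bool) :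
    MeasurePreserving (swapAt (Z := Z) σ) (Measure.pi fun _ : Fin n => μ.prod μ)
      (Measure.pi fun _ : Fin n => μ.prod μ) := by
  have : swapAt (Z := Z) σ = fun z k => (if σ k then Prod.swap else id) (z k) := by
    ext z k <;> by_cases h : σ k <;> simp [swapAt, h]
  rw [this]
  have hk : ∀ k, MeasurePreserving (if σ k then (Prod.swap : Z × Z → Z × Z) else id)
      (μ.prod μ) (μ.prod μ) := fun k => by
    by_cases h : σ k
    · simpa [h] using Measure.measurePreserving_swap
    · simpa [h] using MeasurePreserving.id _
  exact measurePreserving_pi _ _ hk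

theorem card_swapAt_mem_deviationSet_le {Z C : Type*} [Nonempty C] [TopologicalSpace Z] {n : ℕ} (hn : 0 < n)
    (h : (Fin n → Z × Z) → C → Set (Fin n × Bool)) (w : C → ℝ) (hw : SubProb w) {δ : ℝ}
    (hδ : 0 < δ) (hδ2 : δ ≤ 2) (z : Fin n → Z × Z) [DecidablePred fun σ => swapAt σ z ∈ deviationSet h w δ] :
    ((Finset.univ.filter fun σ : Fin n → Bool => swapAt σ z ∈ deviationSet h w δ).card : ℝ) ≤
      2 ^ n * (δ / 2) := by
  classical
  have hn' : (0 : ℝ) < n := Nat.cast_pos.2 hn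
  set a : C → Fin n → ℝ := fun c k =>
    (h z c).indicator (fun _ => (1 : ℝ)) (k, true) - (h z c).indicator (fun _ => (1 : ℝ)) (k, false)
    with ha
  have ha1 : ∀ c k, |a c k| ≤ 1 := fun c k => by
    by_cases h1 : (k, true) ∈ h z c <;> by_cases h2 : (k, false) ∈ h z c <;> simp [ha, h1, h2]
  set v : C → ℝ := fun c => Real.sqrt (2 * n * Real.log (2 / (w c * δ))) with hv
  have key : ∀ σ, swapAt σ z ∈ deviationSet h w δ →
      ∃ c, 0 < w c ∧ v c < ∑ k, boolSign (σ k) * a c k := by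
    rintro σ ⟨E, V, b, -, -, hb, hdesc, hdev⟩
    obtain ⟨c, hsep, hwc⟩ := hdesc z
    have hwpos : 0 < w c := (Real.exp_pos _).trans_le hwc
    refine ⟨c, hwpos, ?_⟩
    have h1 : v c ≤ n * deviation n δ b := by
      have : n * deviation n δ b = Real.sqrt (2 * n * (b + Real.log (2 / δ))) := by
        rw [deviation]
        nth_rewrite 1 [← Real.sqrt_sq hn'.le]
        rw [← Real.sqrt_mul (by positivity)]
        congr 1
        field_simp
      rw [this]
      refine Real.sqrt_le_sqrt (mul_le_mul_of_nonneg_left ?_ (by positivity))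
      have : (2 : ℝ) / (w c * δ) = 2 / δ * (w c)⁻¹ := by field_simp
      rw [this, Real.log_mul (by positivity) (by positivity), Real.log_inv]
      have := Real.log_le_log (Real.exp_pos _) hwc
      rw [Real.log_exp] at this
      linarith
    refine h1.trans_lt ?_
    have h2 : ∑ k, (E.indicator (fun _ => (1 : ℝ)) (swapAt σ z k).2 +
        V.indicator (fun _ => (1 : ℝ)) (swapAt σ z k).1) ≤ ∑ k, boolSign (σ k) * a c k + n := by
      have hsum : ∑ k, boolSign (σ k) * a c k + n = ∑ k, (boolSign (σ k) * a c k + 1) := by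
        simp [Finset.sum_add_distrib]
      rw [hsum]
      refine Finset.sum_le_sum fun k _ => ?_
      have hEle : ∀ p, E.indicator (fun _ => (1 : ℝ)) (samplePt z p) ≤
          (h z c).indicator (fun _ => (1 : ℝ)) p := fun p => by
        by_cases hp : samplePt z p ∈ E
        · rw [Set.indicator_of_mem hp, Set.indicator_of_mem ((hsep p).1 hp)]
        · rw [Set.indicator_of_notMem hp]
          exact Set.indicator_nonneg (fun _ _ => zero_le_one) _
      have hVle : ∀ p, V.indicator (fun _ => (1 : ℝ)) (samplePt z p) ≤
          1 - (h z c).indicator (fun _ => (1 : ℝ)) p := fun p => by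
        by_cases hp : samplePt z p ∈ V
        · rw [Set.indicator_of_mem hp, Set.indicator_of_notMem ((hsep p).2 hp), sub_zero]
        · rw [Set.indicator_of_notMem hp, sub_nonneg]
          exact Set.indicator_le_self' (fun _ _ => zero_le_one) _
      have e1 := hEle (k, true)
      have e2 := hEle (k, false)
      have v1 := hVle (k, true)
      have v2 := hVle (k, false)
      simp only [samplePt, if_true, Bool.false_eq_true, if_false] at e1 e2 v1 v2
      cases hs : σ k
      · simp only [swapAt, hs, boolSign, ha, Bool.false_eq_true, if_false]
        linarith
      · simp only [swapAt, hs, boolSign, ha, if_true, Prod.fst_swap, Prod.snd_swap]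
        linarith
    linarith
  choose! cd hcd using key
  set S := (Finset.univ.filter fun σ : Fin n → Bool => swapAt σ z ∈ deviationSet h w δ) with hS
  have hmap : ∀ σ ∈ S, cd σ ∈ S.image cd := fun σ hσ => Finset.mem_image_of_mem _ hσ
  have hcard := Finset.card_eq_sum_card_fiberwise hmap
  rw [hcard]
  push_cast
  calc ∑ c ∈ S.image cd, ((S.filter fun σ => cd σ = c).card : ℝ)
      ≤ ∑ c ∈ S.image cd, 2 ^ n * (w c * δ / 2) := by
        refine Finset.sum_le_sum fun c hc => ?_
        obtain ⟨σ0, hσ0, rfl⟩ := Finset.mem_image.1 hc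
        have hw0 := (hcd σ0 (Finset.mem_filter.1 hσ0).2).1
        have hw1 : w (cd σ0) ≤ 1 := by simpa using hw.2 {cd σ0}
        refine (le_trans ?_ (card_signed_sum_gt_le hn (a (cd σ0)) (ha1 _)
          (Real.sqrt_nonneg (2 * n * Real.log (2 / (w (cd σ0) * δ)))))).trans_eq ?_
        · refine Nat.cast_le.2 (Finset.card_le_card fun σ hσ => ?_)
          rw [Finset.mem_filter] at hσ
          have := (hcd σ (Finset.mem_filter.1 hσ.1).2).2
          rw [hσ.2] at this
          exact Finset.mem_filter.2 ⟨Finset.mem_univ _, this⟩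
        · have hpos : 0 < w (cd σ0) * δ := mul_pos hw0 hδ
          have h1 : (1 : ℝ) ≤ 2 / (w (cd σ0) * δ) := by
            rw [le_div_iff₀ hpos]; nlinarith
          rw [Real.sq_sqrt (mul_nonneg (by positivity) (Real.log_nonneg h1)),
            mul_div_cancel_left₀ _ (by positivity), ← Real.log_inv, Real.exp_log (by positivity)]
          congr 1
          rw [inv_div]
    _ = 2 ^ n * (δ / 2) * ∑ c ∈ S.image cd, w c := by
        rw [Finset.mul_sum]; exact Finset.sum_congr rfl fun _ _ => by ring
    _ ≤ 2 ^ n * (δ / 2) * 1 := mul_le_mul_of_nonneg_left (hw.2 _) (by positivity)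
    _ = _ := mul_one _

theorem measure_deviationSet_le {Z C : Type*} [Nonempty C] [TopologicalSpace Z] [SecondCountableTopology Z]
    [MeasurableSpace Z] [BorelSpace Z] (μ : Measure Z) [IsProbabilityMeasure μ] {n : ℕ} (hn : 0 < n)
    (h : (Fin n → Z × Z) → C → Set (Fin n × Bool)) (w : C → ℝ) (hw : SubProb w) {δ : ℝ}
    (hδ : 0 < δ) (hδ2 : δ ≤ 2) :
    (Measure.pi fun _ : Fin n => μ.prod μ) (deviationSet h w δ) ≤ ENNReal.ofReal (δ / 2) := by
  classical
  set ν := Measure.pi fun _ : Fin n => μ.prod μ with hν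
  set D := deviationSet h w δ with hD
  have hDm : MeasurableSet D := (isOpen_deviationSet h w δ).measurableSet
  have h1 : ∀ σ : Fin n → Bool, ν D = ∫⁻ z, D.indicator 1 (swapAt σ z) ∂ν := fun σ => by
    rw [(measurePreserving_swapAt μ σ).lintegral_comp (measurable_one.indicator hDm),
      lintegral_indicator_one hDm]
  have h2 : (2 : ENNReal) ^ n * ν D ≤ 2 ^ n * ENNReal.ofReal (δ / 2) := by
    calc (2 : ENNReal) ^ n * ν D = ∑ _σ : Fin n → Bool, ν D := by simp
      _ = ∑ σ : Fin n → Bool, ∫⁻ z, D.indicator 1 (swapAt σ z) ∂ν :=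
          Finset.sum_congr rfl fun σ _ => h1 σ
      _ = ∫⁻ z, ∑ σ : Fin n → Bool, D.indicator 1 (swapAt σ z) ∂ν := by
          rw [lintegral_finsetSum]
          exact fun σ _ => (measurable_one.indicator hDm).comp (measurePreserving_swapAt μ σ).measurable
      _ ≤ ∫⁻ _z, 2 ^ n * ENNReal.ofReal (δ / 2) ∂ν := by
          refine lintegral_mono fun z => ?_
          have hc := card_swapAt_mem_deviationSet_le hn h w hw hδ hδ2 z
          have : ∑ σ : Fin n → Bool, D.indicator (1 : (Fin n → Z × Z) → ENNReal) (swapAt σ z) =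
              ((Finset.univ.filter fun σ : Fin n → Bool => swapAt σ z ∈ D).card : ENNReal) := by
            rw [Finset.card_filter]
            push_cast
            exact Finset.sum_congr rfl fun σ _ => by simp [Set.indicator_apply]
          simp only [this]
          rw [← ENNReal.ofReal_natCast]
          refine (ENNReal.ofReal_le_ofReal hc).trans_eq ?_
          rw [ENNReal.ofReal_mul (by positivity), ENNReal.ofReal_pow two_pos.le]
          simp
      _ = _ := by simp
  exact (ENNReal.mul_le_mul_iff_right (by simp) (by finiteness)).1 h2

/-- **Uniform deviation bound.**  With probability at least `1 - δ`, every describable pair `(E, V)`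
satisfies `μ E ≤ (frequency of Vᶜ) + deviation + 1/(2√n)`. -/
theorem measure_exists_describable_le {Z C : Type*} [Nonempty C] [TopologicalSpace Z] [SecondCountableTopology Z]
    [MeasurableSpace Z] [BorelSpace Z] (μ : Measure Z) [IsProbabilityMeasure μ] {n : ℕ} (hn : 0 < n)
    (h : (Fin n → Z × Z) → C → Set (Fin n × Bool)) (w : C → ℝ) (hw : SubProb w) {δ : ℝ}
    (hδ : 0 < δ) (hδ2 : δ ≤ 2) :
    (Measure.pi fun _ : Fin n => μ)
      {s | ∃ (E V : Set Z) (b : ℝ), IsOpen E ∧ IsOpen V ∧ 0 ≤ b ∧ Describable h w E V b ∧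
        n - ∑ k, V.indicator (fun _ => (1 : ℝ)) (s k) + n * deviation n δ b + Real.sqrt n / 2 <
          n * μ.real E} ≤ ENNReal.ofReal δ := by
  classical
  set P := Measure.pi fun _ : Fin n => μ with hP
  set D := deviationSet h w δ with hD
  have hDm : MeasurableSet D := (isOpen_deviationSet h w δ).measurableSet
  set e := MeasurableEquiv.arrowProdEquivProdArrow Z Z (Fin n) with he
  have hmp : MeasurePreserving e (Measure.pi fun _ : Fin n => μ.prod μ) (P.prod P) :=
    measurePreserving_arrowProdEquivProdArrow Z Z (Fin n) (fun _ => μ) (fun _ => μ)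
  set D' : Set ((Fin n → Z) × (Fin n → Z)) := e.symm ⁻¹' D with hD'
  have hD'm : MeasurableSet D' := e.symm.measurable hDm
  have hmeas : (P.prod P) D' ≤ ENNReal.ofReal (δ / 2) := by
    have : (P.prod P) D' = (Measure.pi fun _ : Fin n => μ.prod μ) D := by
      rw [← hmp.measure_preimage_equiv]
      congr 1
    rw [this]
    exact measure_deviationSet_le μ hn h w hw hδ hδ2
  rw [Measure.prod_apply hD'm] at hmeas
  have hmk := mul_meas_ge_le_lintegral₀ (μ := P) (measurable_measure_prodMk_left (ν := P) hD'm).aemeasurable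
    (1 / 2 : ENNReal)
  have hsub : {s | ∃ (E V : Set Z) (b : ℝ), IsOpen E ∧ IsOpen V ∧ 0 ≤ b ∧ Describable h w E V b ∧
        n - ∑ k, V.indicator (fun _ => (1 : ℝ)) (s k) + n * deviation n δ b + Real.sqrt n / 2 <
          n * μ.real E} ⊆ {s | (1 / 2 : ENNReal) ≤ P (Prod.mk s ⁻¹' D')} := by
    rintro s ⟨E, V, b, hE, hV, hb, hdesc, hlt⟩
    refine (half_le_measure_freq μ hn hE.measurableSet).trans (measure_mono fun s' hs' => ?_)
    refine ⟨E, V, b, hE, hV, hb, hdesc, ?_⟩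
    rw [Set.mem_ofPred_eq] at hs'
    rw [Finset.sum_add_distrib]
    change _ < ∑ k, E.indicator (fun _ => (1 : ℝ)) (s' k) + ∑ k, V.indicator (fun _ => (1 : ℝ)) (s k)
    linarith
  refine (measure_mono hsub).trans ?_
  have h3 := hmk.trans hmeas
  have h4 : (2 : ENNReal) * (1 / 2 * P {s | (1 / 2 : ENNReal) ≤ P (Prod.mk s ⁻¹' D')}) ≤
      2 * ENNReal.ofReal (δ / 2) := by gcongr
  rw [← mul_assoc, ENNReal.mul_div_cancel (by simp) (by simp), one_mul] at h4
  refine h4.trans_eq ?_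
  rw [ENNReal.ofReal_div_of_pos two_pos]
  simp only [ENNReal.ofReal_ofNat]
  exact ENNReal.mul_div_cancel (by simp) (by simp)

/-! ### Weights of the codes -/

theorem SubProb.mul_dep {α β : Type*} {f : α → ℝ} {g : α → β → ℝ} (hf : SubProb f)
    (hg : ∀ a, SubProb (g a)) : SubProb fun p : α × β => f p.1 * g p.1 p.2 := by
  classical
  refine ⟨fun p => mul_nonneg (hf.1 _) ((hg _).1 _), fun S => ?_⟩
  have hsub : S ⊆ S.image Prod.fst ×ˢ S.image Prod.snd := Finset.subset_product
  calc ∑ p ∈ S, f p.1 * g p.1 p.2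
      ≤ ∑ p ∈ S.image Prod.fst ×ˢ S.image Prod.snd, f p.1 * g p.1 p.2 :=
        Finset.sum_le_sum_of_subset_of_nonneg hsub fun p _ _ => mul_nonneg (hf.1 _) ((hg _).1 _)
    _ = ∑ a ∈ S.image Prod.fst, f a * ∑ b ∈ S.image Prod.snd, g a b := by
        rw [Finset.sum_product]; simp_rw [Finset.mul_sum]
    _ ≤ ∑ a ∈ S.image Prod.fst, f a * 1 := Finset.sum_le_sum fun a _ =>
        mul_le_mul_of_nonneg_left ((hg a).2 _) (hf.1 a)
    _ ≤ 1 := by simpa using hf.2 _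

theorem SubProb.pi {ι : Type*} [Fintype ι] {α : ι → Type*} {w : ∀ i, α i → ℝ}
    (hw : ∀ i, SubProb (w i)) : SubProb fun c : ∀ i, α i => ∏ i, w i (c i) := by
  classical
  refine ⟨fun c => Finset.prod_nonneg fun i _ => (hw i).1 _, fun S => ?_⟩
  have hsub : S ⊆ Fintype.piFinset fun i => S.image fun c => c i := fun c hc =>
    Fintype.mem_piFinset.2 fun i => Finset.mem_image_of_mem (fun c : ∀ i, α i => c i) hc
  calc ∑ c ∈ S, ∏ i, w i (c i)
      ≤ ∑ c ∈ Fintype.piFinset fun i => S.image fun c => c i, ∏ i, w i (c i) :=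
        Finset.sum_le_sum_of_subset_of_nonneg hsub fun c _ _ =>
          Finset.prod_nonneg fun i _ => (hw i).1 _
    _ = ∏ i, ∑ a ∈ S.image fun c => c i, w i a := by rw [Finset.prod_univ_sum]
    _ ≤ ∏ _i : ι, (1 : ℝ) := Finset.prod_le_prod
        (fun i _ => Finset.sum_nonneg fun a _ => (hw i).1 a) fun i _ => (hw i).2 _
    _ = 1 := by simp

theorem SubProb.pure {α : Type*} [DecidableEq α] (a : α) :
    SubProb fun b => if b = a then (1 : ℝ) else 0 := by
  refine ⟨fun b => by dsimp only; split_ifs <;> norm_num, fun S => ?_⟩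
  rw [Finset.sum_ite_eq']
  split_ifs <;> norm_num

/-- Weight of a natural number. -/
noncomputable def natWeight (j : ℕ) : ℝ := 1 / ((j + 1) * (j + 2))

theorem sum_range_natWeight (N : ℕ) : ∑ j ∈ Finset.range N, natWeight j = 1 - 1 / (N + 1) := by
  induction N with
  | zero => simp
  | succ N ih =>
    rw [Finset.sum_range_succ, ih, natWeight]
    push_cast
    field_simp
    ring

theorem subProb_natWeight : SubProb natWeight := by
  refine ⟨fun j => by unfold natWeight; positivity, fun S => ?_⟩
  refine (Finset.sum_le_sum_of_subset_of_nonneg S.subset_range_sup_succ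
    fun j _ _ => by unfold natWeight; positivity).trans ?_
  rw [sum_range_natWeight]
  have : (0 : ℝ) ≤ 1 / ((S.sup id + 1 : ℕ) + 1) := by positivity
  linarith

/-- Weight of an integer. -/
noncomputable def intWeight (j : ℤ) : ℝ := 1 / 2 * natWeight j.natAbs

theorem subProb_intWeight : SubProb intWeight := by
  classical
  refine ⟨fun j => mul_nonneg (by norm_num) (subProb_natWeight.1 _), fun S => ?_⟩
  have half : ∀ T : Finset ℤ, Set.InjOn Int.natAbs (T : Set ℤ) → ∑ j ∈ T, intWeight j ≤ 1 / 2 := by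
    intro T hT
    unfold intWeight
    rw [← Finset.mul_sum]
    have : ∑ j ∈ T, natWeight j.natAbs = ∑ k ∈ T.image Int.natAbs, natWeight k :=
      (Finset.sum_image hT).symm
    rw [this]
    have := subProb_natWeight.2 (T.image Int.natAbs)
    linarith
  rw [← Finset.sum_filter_add_sum_filter_not S (fun j => 0 ≤ j)]
  have h1 := half (S.filter fun j => 0 ≤ j) (by
    intro a ha b hb hab
    simp only [Finset.coe_filter, Set.mem_ofPred_eq] at ha hb
    omega)
  have h2 := half (S.filter fun j => ¬ 0 ≤ j) (by
    intro a ha b hb hab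
    simp only [Finset.coe_filter, Set.mem_ofPred_eq] at ha hb
    omega)
  linarith

/-- Weight of a list over a finite alphabet. -/
noncomputable def listWeight {α : Type*} [Fintype α] (l : List α) : ℝ :=
  1 / 2 * (1 / (2 * Fintype.card α)) ^ l.length

theorem listWeight_nonneg {α : Type*} [Fintype α] (l : List α) : 0 ≤ listWeight l := by
  unfold listWeight; positivity

theorem subProb_listWeight {α : Type*} [Fintype α] : SubProb (listWeight (α := α)) := by
  classical
  refine ⟨listWeight_nonneg, fun S => ?_⟩
  set T := S.image List.length with hT
  rw [← Finset.sum_fiberwise_of_maps_to (t := T) (g := List.length)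
    fun l hl => Finset.mem_image_of_mem _ hl]
  have hfib : ∀ k ∈ T, ∑ l ∈ S.filter (fun l => l.length = k), listWeight l ≤ 1 / 2 * (1 / 2) ^ k := by
    intro k _
    have h1 : ∑ l ∈ S.filter (fun l => l.length = k), listWeight l =
        (S.filter fun l => l.length = k).card * (1 / 2 * (1 / (2 * (Fintype.card α : ℝ))) ^ k) := by
      rw [← nsmul_eq_mul, ← Finset.sum_const]
      exact Finset.sum_congr rfl fun l hl => by rw [listWeight, (Finset.mem_filter.1 hl).2]
    have h2 : ((S.filter fun l => l.length = k).card : ℝ) ≤ (Fintype.card α : ℝ) ^ k := by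
      have hsub : S.filter (fun l => l.length = k) ⊆
          Finset.univ.image (List.ofFn : (Fin k → α) → List α) := by
        intro l hl
        obtain ⟨_, rfl⟩ := Finset.mem_filter.1 hl
        exact Finset.mem_image.2 ⟨l.get, Finset.mem_univ _, List.ofFn_get l⟩
      have := (Finset.card_le_card hsub).trans Finset.card_image_le
      rw [Finset.card_univ, Fintype.card_fun, Fintype.card_fin] at this
      exact_mod_cast this
    rw [h1]
    refine (mul_le_mul_of_nonneg_right h2 (by positivity)).trans ?_
    by_cases hN : Fintype.card α = 0
    · rw [hN]
      rcases Nat.eq_zero_or_pos k with rfl | hk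
      · simp
      · simp [hk.ne']
    · have : (0 : ℝ) < Fintype.card α := by positivity
      refine le_of_eq ?_
      rw [one_div_pow, mul_pow, one_div_pow]
      field_simp
  refine (Finset.sum_le_sum hfib).trans ?_
  refine (Finset.sum_le_sum_of_subset_of_nonneg T.subset_range_sup_succ
    fun j _ _ => by positivity).trans ?_
  rw [← Finset.mul_sum, geom_sum_eq (by norm_num)]
  have : (0 : ℝ) ≤ (1 / 2) ^ (T.sup id + 1) := by positivity
  have e : (1 / 2 : ℝ) * (((1 / 2) ^ (T.sup id + 1) - 1) / (1 / 2 - 1)) =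
      1 - (1 / 2) ^ (T.sup id + 1) := by ring
  rw [Nat.succ_eq_add_one, e]
  linarith

open Classical in
/-- Weight of a list of updates together with a scale, the scale being charged for nonempty lists
only. -/
noncomputable def layerWeight {α : Type*} [Fintype α] (c : List α × ℤ) : ℝ :=
  listWeight c.1 * (if c.1 = [] then (if c.2 = 0 then 1 else 0) else intWeight c.2)

theorem subProb_layerWeight {α : Type*} [Fintype α] : SubProb (layerWeight (α := α)) := by
  classical
  have := subProb_listWeight (α := α).mul_dep
    (g := fun l e => if l = [] then (if e = 0 then (1 : ℝ) else 0) else intWeight e) (fun l => by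
      by_cases h : l = []
      · simpa [h] using SubProb.pure (0 : ℤ)
      · simpa [h] using subProb_intWeight)
  convert! this using 2

/-! ### Sparse approximation of filters -/

section Perceptron

variable {ι m d : Type*} [Fintype ι] [Fintype m] [DecidableEq m] [Fintype d]

/-- Euclidean norm of a finite family. -/
noncomputable def l2norm {d : Type*} [Fintype d] (v : d → ℝ) : ℝ := Real.sqrt (∑ i, v i ^ 2)

theorem l2norm_nonneg (v : d → ℝ) : 0 ≤ l2norm v := Real.sqrt_nonneg _

theorem l2norm_sq (v : d → ℝ) : l2norm v ^ 2 = ∑ i, v i ^ 2 :=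
  Real.sq_sqrt (Finset.sum_nonneg fun _ _ => sq_nonneg _)

theorem abs_sum_mul_le_l2norm (v w : d → ℝ) : |∑ i, v i * w i| ≤ l2norm v * l2norm w := by
  refine abs_le_of_sq_le_sq ?_ (mul_nonneg (l2norm_nonneg _) (l2norm_nonneg _))
  rw [mul_pow, l2norm_sq, l2norm_sq]
  exact Finset.sum_mul_sq_le_sq_mul_sq _ _ _

/-- The rank-one filter with direction `v` in row `j`. -/
noncomputable def rowUnit (v : d → ℝ) (j : m) : Matrix m d ℝ :=
  fun j' i => if j' = j then v i / l2norm v else 0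

/-- Subtracting a multiple of a badly fitted direction decreases the norm. -/
theorem l2norm_sub_sq_le (w v : d → ℝ) {s θ : ℝ} (hs : s = 1 ∨ s = -1) (hθ : 0 ≤ θ)
    (h : θ * l2norm v ≤ s * ∑ i, w i * v i) (hv : 0 < l2norm v) :
    l2norm (fun i => w i - s * θ * (v i / l2norm v)) ^ 2 ≤ l2norm w ^ 2 - θ ^ 2 := by
  have hs2 : s ^ 2 = 1 := by rcases hs with rfl | rfl <;> norm_num
  have e : ∀ i, (w i - s * θ * (v i / l2norm v)) ^ 2 =
      w i ^ 2 - 2 * θ / l2norm v * (s * (w i * v i)) + s ^ 2 * θ ^ 2 / l2norm v ^ 2 * v i ^ 2 :=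
    fun i => by field_simp; ring
  rw [l2norm_sq (fun i => w i - s * θ * (v i / l2norm v))]
  simp_rw [e]
  rw [Finset.sum_add_distrib, Finset.sum_sub_distrib, ← Finset.mul_sum, ← Finset.mul_sum,
    ← Finset.mul_sum, ← l2norm_sq w, ← l2norm_sq v, hs2]
  have h1 : 2 * θ / l2norm v * (θ * l2norm v) ≤ 2 * θ / l2norm v * (s * ∑ i, w i * v i) :=
    mul_le_mul_of_nonneg_left h (by positivity)
  have h2 : 2 * θ / l2norm v * (θ * l2norm v) = 2 * θ ^ 2 := by field_simp
  have h3 : 1 * θ ^ 2 / l2norm v ^ 2 * l2norm v ^ 2 = θ ^ 2 := by field_simp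
  rw [h3]
  linarith

/-- **Perceptron approximation.**  Each row `j` is fitted to accuracy `θ j` with few updates along
the vectors `v i`.  Rows that are already within the accuracy need no step size. -/
theorem exists_updates (v : ι → d → ℝ) {n : ℕ} (τ : ℝ) (θ : m → ℝ)
    (N : ℕ) : ∀ Δ : Matrix m d ℝ,
    (∀ j, (0 < θ j ∧ ∃ q : Fin n, θ j = τ * (1 / 2) ^ (q : ℕ)) ∨ l2norm (Δ j) ≤ θ j) →
    ∑ j, l2norm (Δ j) ^ 2 / θ j ^ 2 < N + 1 →
    ∃ ℓ : List (ι × m × Bool × Fin n), (ℓ.length : ℝ) ≤ ∑ j, l2norm (Δ j) ^ 2 / θ j ^ 2 ∧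
      ∀ i j, |∑ a, (Δ j a - τ * ((ℓ.map fun t => (boolSign t.2.2.1 * (1 / 2) ^ (t.2.2.2 : ℕ)) •
        rowUnit (v t.1) t.2.1).sum : Matrix m d ℝ) j a) * v i a| ≤ θ j * l2norm (v i) := by
  induction N with
  | zero =>
    intro Δ hθ hN
    refine ⟨[], by simpa using Finset.sum_nonneg fun _ _ => by positivity, fun i j => ?_⟩
    simp only [List.map_nil, List.sum_nil, Matrix.zero_apply, mul_zero, sub_zero]
    refine (abs_sum_mul_le_l2norm _ _).trans (mul_le_mul_of_nonneg_right ?_ (l2norm_nonneg _))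
    rcases hθ j with ⟨hpos, _⟩ | h
    · have h1 : l2norm (Δ j) ^ 2 / θ j ^ 2 ≤ ∑ j, l2norm (Δ j) ^ 2 / θ j ^ 2 :=
        Finset.single_le_sum (f := fun j => l2norm (Δ j) ^ 2 / θ j ^ 2)
          (fun _ _ => by positivity) (Finset.mem_univ j)
      have h2 : l2norm (Δ j) ^ 2 / θ j ^ 2 ≤ 1 := by
        simp only [Nat.cast_zero, zero_add] at hN; linarith
      rw [div_le_one (by positivity)] at h2
      exact le_of_sq_le_sq h2 hpos.le
    · exact h
  | succ N ih =>
    intro Δ hθ hN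
    by_cases hall : ∀ i j, |∑ a, Δ j a * v i a| ≤ θ j * l2norm (v i)
    · refine ⟨[], by simpa using Finset.sum_nonneg fun _ _ => by positivity, fun i j => ?_⟩
      simpa using hall i j
    push Not at hall
    obtain ⟨i₀, j₀, hbad⟩ := hall
    have hcs := abs_sum_mul_le_l2norm (Δ j₀) (v i₀)
    have hvpos : 0 < l2norm (v i₀) := by
      rcases (l2norm_nonneg (v i₀)).eq_or_lt with h | h
      · rw [← h, mul_zero] at hbad hcs; linarith
      · exact h
    have hgt : θ j₀ < l2norm (Δ j₀) := lt_of_mul_lt_mul_right (hbad.trans_le hcs) hvpos.le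
    obtain ⟨hθpos, q, hq⟩ : 0 < θ j₀ ∧ ∃ q : Fin n, θ j₀ = τ * (1 / 2) ^ (q : ℕ) :=
      (hθ j₀).resolve_right (not_le.2 hgt)
    obtain ⟨b, hb⟩ : ∃ b : Bool, θ j₀ * l2norm (v i₀) ≤ boolSign b * ∑ a, Δ j₀ a * v i₀ a := by
      rcases abs_cases (∑ a, Δ j₀ a * v i₀ a) with ⟨h, _⟩ | ⟨h, _⟩
      · exact ⟨false, by simp only [boolSign, Bool.false_eq_true, if_false, one_mul]; linarith⟩
      · exact ⟨true, by simp only [boolSign, if_true, neg_one_mul]; linarith⟩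
    have hbs : boolSign b = 1 ∨ boolSign b = -1 := by cases b <;> simp [boolSign]
    set Δ' : Matrix m d ℝ := fun j a =>
      Δ j a - τ * ((boolSign b * (1 / 2) ^ (q : ℕ)) • rowUnit (v i₀) j₀ : Matrix m d ℝ) j a with hΔ'
    have hrow0 : Δ' j₀ = fun a => Δ j₀ a - boolSign b * θ j₀ * (v i₀ a / l2norm (v i₀)) := by
      ext a
      simp only [hΔ', Matrix.smul_apply, rowUnit, if_true, smul_eq_mul, hq]
      ring
    have hrow : ∀ j, j ≠ j₀ → Δ' j = Δ j := fun j hj => by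
      ext a; simp [hΔ', rowUnit, hj]
    have hdec : l2norm (Δ' j₀) ^ 2 ≤ l2norm (Δ j₀) ^ 2 - θ j₀ ^ 2 := by
      rw [hrow0]; exact l2norm_sub_sq_le _ _ hbs hθpos.le hb hvpos
    have hpot : ∑ j, l2norm (Δ' j) ^ 2 / θ j ^ 2 + 1 ≤ ∑ j, l2norm (Δ j) ^ 2 / θ j ^ 2 := by
      rw [← Finset.add_sum_erase _ _ (Finset.mem_univ j₀), ← Finset.add_sum_erase _
        (fun j => l2norm (Δ j) ^ 2 / θ j ^ 2) (Finset.mem_univ j₀)]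
      have h1 : ∑ j ∈ Finset.univ.erase j₀, l2norm (Δ' j) ^ 2 / θ j ^ 2 =
          ∑ j ∈ Finset.univ.erase j₀, l2norm (Δ j) ^ 2 / θ j ^ 2 :=
        Finset.sum_congr rfl fun j hj => by rw [hrow j (Finset.ne_of_mem_erase hj)]
      have h2 : l2norm (Δ' j₀) ^ 2 / θ j₀ ^ 2 ≤ l2norm (Δ j₀) ^ 2 / θ j₀ ^ 2 - 1 := by
        rw [div_le_iff₀ (by positivity), sub_mul, div_mul_cancel₀ _ (by positivity), one_mul]
        exact hdec
      linarith
    obtain ⟨ℓ, hlen, hℓ⟩ := ih Δ' (fun j => by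
      by_cases hj : j = j₀
      · exact Or.inl (hj ▸ ⟨hθpos, q, hq⟩)
      · rw [hrow j hj]; exact hθ j) (by push_cast at hN; linarith)
    refine ⟨(i₀, j₀, b, q) :: ℓ, ?_, fun i j => ?_⟩
    · rw [List.length_cons]; push_cast; linarith
    · refine le_trans (le_of_eq ?_) (hℓ i j)
      congr 1
      refine Finset.sum_congr rfl fun a _ => ?_
      simp only [hΔ', List.map_cons, List.sum_cons, Matrix.add_apply]
      ring

end Perceptron

namespace ConvNet

/-! ### Approximation of one layer -/

variable (net : ConvNet)

/-- The `o`-th patch of `x`, as a vector. -/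
def patchVec (l : ℕ) (x : net.Act l) (o : Fin (net.O l)) : Fin (net.d (l + 1)) → ℝ :=
  fun i => x (net.patch l o i).1 (net.patch l o i).2

theorem l2norm_patchVec_le (l : ℕ) (x : net.Act l) (o : Fin (net.O l)) :
    l2norm (net.patchVec l x o) ≤ net.patchNorm l x :=
  le_ciSup (f := fun o => l2norm (net.patchVec l x o)) (Set.finite_range _).bddAbove o

theorem patchNorm_nonneg (l : ℕ) (x : net.Act l) : 0 ≤ net.patchNorm l x :=
  Real.iSup_nonneg fun _ => Real.sqrt_nonneg _

/-- An elementary update of the filters of layer `l`: a patch of a point of the double sample, a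
row, a sign and a step exponent. -/
abbrev Upd (n l : ℕ) : Type :=
  ((Fin n × Bool) × Fin (net.O l)) × Fin (net.m (l + 1)) × Bool × Fin n

/-- The filters obtained from `M` by a list of updates at scale `2 ^ e`, where `u` lists the
activations on the double sample. -/
noncomputable def decode {n l : ℕ} (M : net.Wt l) (u : Fin n × Bool → net.Act l)
    (c : List (net.Upd n l) × ℤ) : net.Wt l :=
  M + (2 : ℝ) ^ c.2 • (c.1.map fun t => (boolSign t.2.2.1 * (1 / 2) ^ (t.2.2.2 : ℕ)) •
    rowUnit (net.patchVec l (u t.1.1) t.1.2) t.2.1).sum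

theorem decode_nil {n l : ℕ} (M : net.Wt l) (u : Fin n × Bool → net.Act l) (e e' : ℤ) :
    net.decode M u ([], e) = net.decode M u ([], e') := by
  simp [decode]

theorem exists_decode {n l : ℕ} (M A : net.Wt l) (u : Fin n × Bool → net.Act l) (e : ℤ)
    (θ : Fin (net.m (l + 1)) → ℝ)
    (hθ : ∀ j, (0 < θ j ∧ ∃ q : Fin n, θ j = (2 : ℝ) ^ e * (1 / 2) ^ (q : ℕ)) ∨
      l2norm ((A - M) j) ≤ θ j) :
    ∃ ℓ : List (net.Upd n l), (ℓ.length : ℝ) ≤ ∑ j, l2norm ((A - M) j) ^ 2 / θ j ^ 2 ∧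
      ∀ p j o, |(net.conv l A (u p) - net.conv l (net.decode M u (ℓ, e)) (u p)) j o| ≤
        θ j * net.patchNorm l (u p) := by
  obtain ⟨ℓ, hlen, hℓ⟩ := exists_updates
    (fun i : (Fin n × Bool) × Fin (net.O l) => net.patchVec l (u i.1) i.2) ((2 : ℝ) ^ e) θ
    ⌊∑ j, l2norm ((A - M) j) ^ 2 / θ j ^ 2⌋₊ (A - M) hθ (Nat.lt_floor_add_one _)
  refine ⟨ℓ, hlen, fun p j o => ?_⟩
  have hθ0 : 0 ≤ θ j := by
    rcases hθ j with h | h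
    · exact h.1.le
    · exact (l2norm_nonneg _).trans h
  refine le_trans (le_of_eq ?_) ((hℓ (p, o) j).trans
    (mul_le_mul_of_nonneg_left (net.l2norm_patchVec_le l (u p) o) hθ0))
  simp only [conv, Pi.sub_apply, ← Finset.sum_sub_distrib]
  congr 1
  refine Finset.sum_congr rfl fun a _ => ?_
  simp only [decode, Matrix.add_apply, Matrix.smul_apply, smul_eq_mul, Matrix.sub_apply, patchVec]
  ring

/-- The layer `l` can be approximated, at every scale and on every double sample, by a list of
updates of `M` whose length is controlled by the size `a A` of `A - M`. -/
def LayerApprox (n l : ℕ) (normA : ∀ l, Seminorm ℝ (net.Act l)) (M : net.Wt l) (a : net.Wt l → ℝ)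
    (r : ℝ) : Prop :=
  ∀ (u : Fin n × Bool → net.Act l) (A : net.Wt l) (e : ℤ), (2 * a A) ^ 2 ≤ n * ((2 : ℝ) ^ e) ^ 2 →
    ∃ ℓ : List (net.Upd n l), (ℓ.length : ℝ) * ((2 : ℝ) ^ e) ^ 2 ≤ (2 * a A) ^ 2 ∧
      ∀ p, normA (l + 1) (net.layer l A (u p) - net.layer l (net.decode M u (ℓ, e)) (u p)) ≤
        r * (2 : ℝ) ^ e * net.patchNorm l (u p)

theorem distFr_sq (l : ℕ) (A M : net.Wt l) :
    net.distFr l A M ^ 2 = ∑ j, l2norm ((A - M) j) ^ 2 := by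
  rw [distFr, Real.sq_sqrt (Finset.sum_nonneg fun _ _ => Finset.sum_nonneg fun _ _ => sq_nonneg _)]
  simp_rw [l2norm_sq]
  rfl

theorem dist21_eq (l : ℕ) (A M : net.Wt l) : net.dist21 l A M = ∑ j, l2norm ((A - M) j) := rfl

theorem distFr_nonneg (l : ℕ) (A M : net.Wt l) : 0 ≤ net.distFr l A M := Real.sqrt_nonneg _

theorem dist21_nonneg (l : ℕ) (A M : net.Wt l) : 0 ≤ net.dist21 l A M :=
  Finset.sum_nonneg fun _ _ => Real.sqrt_nonneg _

theorem distFr_le_dist21 (l : ℕ) (A M : net.Wt l) : net.distFr l A M ≤ net.dist21 l A M := by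
  refine le_of_sq_le_sq ?_ (net.dist21_nonneg l A M)
  rw [distFr_sq, dist21_eq]
  exact Finset.sum_sq_le_sq_sum_of_nonneg fun _ _ => l2norm_nonneg _

theorem layerApprox_distFr {n : ℕ} (hn : 0 < n) (l : ℕ) (normA : ∀ l, Seminorm ℝ (net.Act l))
    (M : net.Wt l) (ρ : ℝ≥0) (hG : LipschitzWith ρ (net.G l)) (k : ℝ)
    (hk : ∀ x : net.Act (l + 1), normA (l + 1) x ≤ Real.sqrt k * ‖x‖) :
    net.LayerApprox n l normA M (fun A => net.distFr l A M) (ρ * Real.sqrt k) := by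
  intro u A e _
  have he : (0 : ℝ) < 2 ^ e := by positivity
  obtain ⟨ℓ, hlen, hℓ⟩ := net.exists_decode M A u e (fun _ => (2 : ℝ) ^ e)
    fun j => Or.inl ⟨he, ⟨0, hn⟩, by simp⟩
  refine ⟨ℓ, ?_, fun p => ?_⟩
  · rw [← Finset.sum_div, ← distFr_sq, le_div_iff₀ (by positivity)] at hlen
    refine hlen.trans ?_
    nlinarith [sq_nonneg (net.distFr l A M)]
  · refine (hk _).trans ?_
    have h1 : ‖net.conv l A (u p) - net.conv l (net.decode M u (ℓ, e)) (u p)‖ ≤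
        2 ^ e * net.patchNorm l (u p) := by
      have h0 : 0 ≤ (2 : ℝ) ^ e * net.patchNorm l (u p) :=
        mul_nonneg he.le (net.patchNorm_nonneg _ _)
      exact (pi_norm_le_iff_of_nonneg h0).2 fun j => (pi_norm_le_iff_of_nonneg h0).2 fun o =>
        hℓ p j o
    have h2 := hG.dist_le_mul (net.conv l A (u p)) (net.conv l (net.decode M u (ℓ, e)) (u p))
    rw [dist_eq_norm, dist_eq_norm] at h2
    calc Real.sqrt k * ‖net.layer l A (u p) - net.layer l (net.decode M u (ℓ, e)) (u p)‖
        ≤ Real.sqrt k * (ρ * (2 ^ e * net.patchNorm l (u p))) :=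
          mul_le_mul_of_nonneg_left (h2.trans (mul_le_mul_of_nonneg_left h1 ρ.2))
            (Real.sqrt_nonneg _)
      _ = _ := by ring

theorem layerApprox_dist21 {n : ℕ} (l : ℕ) (normA : ∀ l, Seminorm ℝ (net.Act l))
    (M : net.Wt l) (ρ : ℝ≥0)
    (hG : ∀ z z' : net.PreAct l, pixelNorm (net.G l z - net.G l z') ≤ ρ * pixelNorm (z - z'))
    (κ : ℝ) (hκ : ∀ x : net.Act (l + 1), normA (l + 1) x ≤ Real.sqrt κ * pixelNorm x) :
    net.LayerApprox n l normA M (fun A => net.dist21 l A M) (ρ * Real.sqrt κ) := by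
  intro u A e hn
  dsimp only at hn ⊢
  have he : (0 : ℝ) < 2 ^ e := by positivity
  set τ : ℝ := 2 ^ e with hτ
  set a : Fin (net.m (l + 1)) → ℝ := fun j => l2norm ((A - M) j) with ha
  have ha0 : ∀ j, 0 ≤ a j := fun j => l2norm_nonneg _
  set s : ℝ := ∑ j, a j with hs
  have hd : net.dist21 l A M = s := rfl
  rw [hd] at hn ⊢
  have hs0 : 0 ≤ s := Finset.sum_nonneg fun j _ => ha0 j
  have hle : ∀ j, a j ≤ s := fun j => Finset.single_le_sum (fun j _ => ha0 j) (Finset.mem_univ j)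
  have key : ∀ j, ∃ θ : ℝ, ((0 < θ ∧ ∃ q : Fin n, θ = τ * (1 / 2) ^ (q : ℕ)) ∨ a j ≤ θ) ∧
      θ ^ 2 * s ≤ τ ^ 2 * a j ∧ a j ^ 2 / θ ^ 2 ≤ 4 * (a j * s) / τ ^ 2 ∧ (a j = 0 → θ = 0) := by
    intro j
    rcases (ha0 j).eq_or_lt with h0 | hpos
    · exact ⟨0, Or.inr h0.symm.le, by simp [← h0], by simp [← h0], fun _ => rfl⟩
    have hspos : 0 < s := hpos.trans_le (hle j)
    by_cases hsmall : a j ≤ τ * Real.sqrt (a j / s)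
    · have hsq : (τ * Real.sqrt (a j / s)) ^ 2 = τ ^ 2 * (a j / s) := by
        rw [mul_pow, Real.sq_sqrt (by positivity)]
      refine ⟨τ * Real.sqrt (a j / s), Or.inr hsmall, ?_, ?_, fun h => absurd h hpos.ne'⟩
      · rw [hsq]; refine le_of_eq ?_; field_simp
      · rw [hsq]
        have : a j ^ 2 / (τ ^ 2 * (a j / s)) = a j * s / τ ^ 2 := by field_simp
        rw [this]
        exact div_le_div_of_nonneg_right (by nlinarith [mul_pos hpos hspos]) (by positivity)
    · rw [not_le] at hsmall
      have hbig : τ ^ 2 < a j * s := by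
        have h1 : (τ * Real.sqrt (a j / s)) ^ 2 < a j ^ 2 := by
          have : 0 ≤ τ * Real.sqrt (a j / s) := by positivity
          nlinarith
        rw [mul_pow, Real.sq_sqrt (by positivity), ← mul_div_assoc, div_lt_iff₀ hspos] at h1
        nlinarith
      obtain ⟨q, hq1, hq2⟩ := exists_nat_pow_near_of_lt_one (x := a j / s) (y := (1 / 4 : ℝ))
        (by positivity) ((div_le_one hspos).2 (hle j)) (by norm_num) (by norm_num)
      have hqn : q + 1 < n := by
        have h1 : (1 / 4 : ℝ) ^ q * 1 ≥ a j / s := by linarith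
        have h2 : (4 : ℝ) ^ (q + 1) < n := by
          have h3 : (4 : ℝ) ^ q * (a j / s) ≤ 1 := by
            have : (4 : ℝ) ^ q * (1 / 4) ^ q = 1 := by rw [← mul_pow]; norm_num
            calc (4 : ℝ) ^ q * (a j / s) ≤ 4 ^ q * (1 / 4) ^ q := by gcongr
              _ = 1 := this
          rw [← mul_div_assoc, div_le_one hspos] at h3
          have h4 : (4 : ℝ) ^ q * τ ^ 2 < s ^ 2 := by
            have h5 : (4 : ℝ) ^ q * τ ^ 2 < 4 ^ q * (a j * s) := by gcongr
            nlinarith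
          have h6 : (4 : ℝ) ^ (q + 1) * τ ^ 2 < n * τ ^ 2 := by
            rw [pow_succ]; nlinarith
          exact lt_of_mul_lt_mul_right h6 (by positivity)
        have h3 : 4 ^ (q + 1) < n := by exact_mod_cast h2
        exact (Nat.lt_pow_self (by norm_num)).trans h3
      have hsq : (τ * (1 / 2) ^ (q + 1)) ^ 2 = τ ^ 2 * (1 / 4) ^ (q + 1) := by
        rw [mul_pow, ← pow_mul, mul_comm (q + 1) 2, pow_mul]; norm_num
      refine ⟨τ * (1 / 2) ^ (q + 1), Or.inl ⟨by positivity, ⟨q + 1, hqn⟩, rfl⟩, ?_, ?_,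
        fun h => absurd h hpos.ne'⟩
      · rw [hsq, mul_assoc]
        refine mul_le_mul_of_nonneg_left ?_ (by positivity)
        have := (lt_div_iff₀ hspos).1 hq1
        exact this.le
      · rw [hsq, div_le_div_iff₀ (by positivity) (by positivity)]
        have h1 := (div_le_iff₀ hspos).1 hq2
        rw [pow_succ (1 / 4 : ℝ) q]
        have h2 : a j * (a j * τ ^ 2) ≤ (1 / 4) ^ q * s * (a j * τ ^ 2) := by gcongr
        nlinarith
  choose θ h1 h2 h3 h4 using key
  obtain ⟨ℓ, hlen, hℓ⟩ := net.exists_decode M A u e θ h1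
  refine ⟨ℓ, ?_, fun p => ?_⟩
  · have : (ℓ.length : ℝ) ≤ 4 * (s * s) / τ ^ 2 := by
      refine hlen.trans ((Finset.sum_le_sum fun j _ => h3 j).trans_eq ?_)
      rw [← Finset.sum_div, ← Finset.mul_sum, ← Finset.sum_mul]
    rw [le_div_iff₀ (by positivity)] at this
    linarith
  · refine (hκ _).trans ?_
    have hpn := net.patchNorm_nonneg l (u p)
    have hsum : ∑ j, θ j ^ 2 ≤ τ ^ 2 := by
      rcases hs0.eq_or_lt with h | h
      · have hz : ∀ j, θ j = 0 := fun j => h4 j (le_antisymm ((hle j).trans h.symm.le) (ha0 j))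
        simp only [hz]
        simp
        positivity
      · have := Finset.sum_le_sum fun j (_ : j ∈ Finset.univ) => h2 j
        rw [← Finset.sum_mul, ← Finset.mul_sum] at this
        exact le_of_mul_le_mul_right this h
    have hpix : pixelNorm (net.conv l A (u p) - net.conv l (net.decode M u (ℓ, e)) (u p)) ≤
        τ * net.patchNorm l (u p) := by
      refine Real.iSup_le (fun o => ?_) (by positivity)
      refine Real.sqrt_le_iff.2 ⟨by positivity, ?_⟩
      calc _ ≤ ∑ j, (θ j * net.patchNorm l (u p)) ^ 2 := Finset.sum_le_sum fun j _ =>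
            sq_le_sq' (neg_le_of_abs_le (hℓ p j o)) (le_of_abs_le (hℓ p j o))
        _ = (∑ j, θ j ^ 2) * net.patchNorm l (u p) ^ 2 := by
            rw [Finset.sum_mul]; exact Finset.sum_congr rfl fun _ _ => by ring
        _ ≤ τ ^ 2 * net.patchNorm l (u p) ^ 2 := by gcongr
        _ = _ := by ring
    calc Real.sqrt κ * pixelNorm (net.layer l A (u p) - net.layer l (net.decode M u (ℓ, e)) (u p))
        ≤ Real.sqrt κ * (ρ * (τ * net.patchNorm l (u p))) :=
          mul_le_mul_of_nonneg_left ((hG _ _).trans (mul_le_mul_of_nonneg_left hpix ρ.2))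
            (Real.sqrt_nonneg _)
      _ = _ := by ring

end ConvNet

namespace ConvNet

variable (net : ConvNet)

/-! ### Approximation of the network -/

theorem layer_zero (l : ℕ) (hG0 : net.G l 0 = 0) (A : net.Wt l) : net.layer l A 0 = 0 := by
  have : net.conv l A 0 = 0 := by
    ext j o; simp [conv]
  rw [layer, this, hG0]

theorem normA_F_le (normA : ∀ l, Seminorm ℝ (net.Act l)) (normW : ∀ l, Seminorm ℝ (net.Wt l))
    (hG0 : ∀ l < net.L, net.G l 0 = 0)
    (hLip : ∀ l < net.L, ∀ (A : net.Wt l) (x y : net.Act l),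
      normA (l + 1) (net.layer l A x - net.layer l A y) ≤ normW l A * normA l (x - y))
    (A : ∀ l, net.Wt l) (x : net.Act 0) (l : ℕ) (hl : l ≤ net.L) :
    normA l (net.F A l x) ≤ normA 0 x * ∏ i ∈ Finset.range l, normW i (A i) := by
  induction l with
  | zero => simp [F]
  | succ l ih =>
    have h := hLip l hl (A l) (net.F A l x) 0
    rw [net.layer_zero l (hG0 l hl), sub_zero, sub_zero] at h
    rw [Finset.prod_range_succ]
    have := mul_le_mul_of_nonneg_left (ih (Nat.le_of_succ_le hl)) (apply_nonneg (normW l) (A l))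
    calc normA (l + 1) (net.F A (l + 1) x) ≤ normW l (A l) * normA l (net.F A l x) := h
      _ ≤ _ := this
      _ = _ := by ring

/-- The activations on the double sample of the network described by a code. -/
noncomputable def codeAct {n : ℕ} (M : ∀ l, net.Wt l) (z : Fin n × Bool → net.Act 0)
    (c : ∀ l, List (net.Upd n l) × ℤ) : (l : ℕ) → Fin n × Bool → net.Act l
  | 0 => z
  | l + 1 => fun p => net.layer l (net.decode (M l) (codeAct M z c l) (c l)) (codeAct M z c l p)

theorem exists_code {n : ℕ} (normA : ∀ l, Seminorm ℝ (net.Act l))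
    (normW : ∀ l, Seminorm ℝ (net.Wt l)) (hG0 : ∀ l < net.L, net.G l 0 = 0)
    (hpatch : ∀ l < net.L, ∀ x : net.Act l, net.patchNorm l x ≤ normA l x)
    (hLip : ∀ l < net.L, ∀ (A : net.Wt l) (x y : net.Act l),
      normA (l + 1) (net.layer l A x - net.layer l A y) ≤ normW l A * normA l (x - y))
    (M : ∀ l, net.Wt l) (a : ∀ l, net.Wt l → ℝ) (r : ℕ → ℝ) (hr : ∀ l < net.L, 0 ≤ r l)
    (happ : ∀ l < net.L, net.LayerApprox n l normA (M l) (a l) (r l))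
    (A : ∀ l, net.Wt l) (β α : ℕ → ℝ) (hβ : ∀ l, normW l (A l) ≤ β l) (hβ0 : ∀ l, 0 < β l)
    (hα : ∀ l < net.L, 0 ≤ α l) (hα1 : ∑ l ∈ Finset.range net.L, α l ≤ 1)
    {x₀ ε : ℝ} (hx₀ : 0 < x₀) (hε : 0 < ε) (hεx : ε ≤ x₀ * ∏ i ∈ Finset.range net.L, β i)
    (e : ℕ → ℤ)
    (he : ∀ l < net.L, r l * 2 ^ e l * (2 * x₀ * ∏ i ∈ Finset.range l, β i) *
      ∏ i ∈ Finset.Ico (l + 1) net.L, β i ≤ α l * ε)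
    (hen : ∀ l < net.L, (2 * a l (A l)) ^ 2 ≤ n * ((2 : ℝ) ^ e l) ^ 2)
    (z : Fin n × Bool → net.Act 0) :
    ∃ c : ∀ l, List (net.Upd n l) × ℤ,
      (∀ l < net.L, ((c l).1.length : ℝ) * ((2 : ℝ) ^ e l) ^ 2 ≤ (2 * a l (A l)) ^ 2 ∧
        ((c l).1 = [] → (c l).2 = 0) ∧ ((c l).1 ≠ [] → (c l).2 = e l)) ∧
      ∀ p, normA 0 (z p) ≤ x₀ →
        normA net.L (net.F A net.L (z p) - net.codeAct M z c net.L p) ≤ ε := by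
  classical
  have hex : ∀ (l : ℕ) (u : Fin n × Bool → net.Act l), ∃ ℓ : List (net.Upd n l), l < net.L →
      (ℓ.length : ℝ) * ((2 : ℝ) ^ e l) ^ 2 ≤ (2 * a l (A l)) ^ 2 ∧
      ∀ p, normA (l + 1) (net.layer l (A l) (u p) -
        net.layer l (net.decode (M l) u (ℓ, e l)) (u p)) ≤ r l * (2 : ℝ) ^ e l *
          net.patchNorm l (u p) := by
    intro l u
    by_cases hl : l < net.L
    · obtain ⟨ℓ, h⟩ := happ l hl u (A l) (e l) (hen l hl)
      exact ⟨ℓ, fun _ => h⟩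
    · exact ⟨[], fun h => absurd h hl⟩
  choose ℓ hℓ using hex
  let u : (l : ℕ) → Fin n × Bool → net.Act l := fun l => Nat.rec (motive := fun l => Fin n × Bool → net.Act l) z
    (fun l ul p => net.layer l (net.decode (M l) ul (ℓ l ul, e l)) (ul p)) l
  have hu : ∀ l p, u (l + 1) p = net.layer l (net.decode (M l) (u l) (ℓ l (u l), e l)) (u l p) :=
    fun l p => rfl
  set c : ∀ l, List (net.Upd n l) × ℤ := fun l =>
    (ℓ l (u l), if ℓ l (u l) = [] then 0 else e l) with hc
  have hdec : ∀ l, net.decode (M l) (u l) (c l) = net.decode (M l) (u l) (ℓ l (u l), e l) := by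
    intro l
    by_cases h : ℓ l (u l) = []
    · simp only [hc, h, if_true]; exact net.decode_nil _ _ _ _
    · simp only [hc, h, if_false]
  have hact : ∀ l, net.codeAct M z c l = u l := by
    intro l
    induction l with
    | zero => rfl
    | succ l ih => ext1 p; rw [codeAct, ih, hdec, hu]
  refine ⟨c, fun l hl => ⟨(hℓ l (u l) hl).1, fun h => ?_, fun h => ?_⟩, ?_⟩
  · simp only [hc] at h ⊢; simp [h]
  · simp only [hc] at h ⊢; simp [h]
  intro p hp
  rw [hact]
  set pre : ℕ → ℝ := fun l => ∏ i ∈ Finset.range l, β i with hpre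
  set suf : ℕ → ℝ := fun l => ∏ i ∈ Finset.Ico l net.L, β i with hsuf
  have hpre0 : ∀ l, 0 < pre l := fun l => Finset.prod_pos fun i _ => hβ0 i
  have hsuf0 : ∀ l, 0 < suf l := fun l => Finset.prod_pos fun i _ => hβ0 i
  have main : ∀ l, l ≤ net.L → normA l (net.F A l (z p) - u l p) * suf l ≤
      (∑ i ∈ Finset.range l, α i) * ε := by
    intro l
    induction l with
    | zero => intro _; simp [F, u]
    | succ l ih =>
      intro hl
      have hl' : l < net.L := hl
      have ih := ih hl'.le
      set E := normA l (net.F A l (z p) - u l p) with hE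
      have hsucc : suf l = β l * suf (l + 1) := Finset.prod_eq_prod_Ico_succ_bot hl' β
      have hsplit : pre l * suf l = ∏ i ∈ Finset.range net.L, β i :=
        Finset.prod_range_mul_prod_Ico β hl'.le
      have hαl : ∑ i ∈ Finset.range l, α i ≤ 1 := by
        refine (Finset.sum_le_sum_of_subset_of_nonneg (Finset.range_subset_range.2 hl'.le)
          fun i hi _ => hα i (Finset.mem_range.1 hi)).trans hα1
      have hEb : E ≤ x₀ * pre l := by
        have h1 : E * suf l ≤ x₀ * pre l * suf l := by
          rw [mul_assoc, hsplit]
          refine ih.trans (le_trans ?_ hεx)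
          nlinarith
        exact le_of_mul_le_mul_right h1 (hsuf0 l)
      have hFb : normA l (net.F A l (z p)) ≤ x₀ * pre l := by
        refine (net.normA_F_le normA normW hG0 hLip A (z p) l hl'.le).trans ?_
        refine mul_le_mul hp (Finset.prod_le_prod (fun i _ => apply_nonneg _ _) fun i _ => hβ i)
          (Finset.prod_nonneg fun i _ => apply_nonneg _ _) hx₀.le
      have hub : net.patchNorm l (u l p) ≤ 2 * x₀ * pre l := by
        refine (hpatch l hl' _).trans ?_
        have : u l p = net.F A l (z p) - (net.F A l (z p) - u l p) := by abel
        rw [this]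
        refine (map_sub_le_add (normA l) _ _).trans ?_
        linarith
      have hstep : normA (l + 1) (net.F A (l + 1) (z p) - u (l + 1) p) ≤
          normW l (A l) * E + r l * 2 ^ e l * (2 * x₀ * pre l) := by
        have h1 := hLip l hl' (A l) (net.F A l (z p)) (u l p)
        have h2 := (hℓ l (u l) hl').2 p
        have h3 : net.F A (l + 1) (z p) - u (l + 1) p =
            (net.layer l (A l) (net.F A l (z p)) - net.layer l (A l) (u l p)) +
            (net.layer l (A l) (u l p) - u (l + 1) p) := by
          simp only [F]; abel
        rw [h3, hu]
        refine (map_add_le_add (normA (l + 1)) _ _).trans (add_le_add h1 (h2.trans ?_))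
        exact mul_le_mul_of_nonneg_left hub (mul_nonneg (hr l hl') (by positivity))
      rw [Finset.sum_range_succ, add_mul]
      have h4 := mul_le_mul_of_nonneg_right hstep (hsuf0 (l + 1)).le
      rw [add_mul] at h4
      have h5 : normW l (A l) * E * suf (l + 1) ≤ E * suf l := by
        rw [hsucc]
        have hE0 : 0 ≤ E := apply_nonneg _ _
        have := mul_le_mul_of_nonneg_right (hβ l) (mul_nonneg hE0 (hsuf0 (l + 1)).le)
        linarith
      exact h4.trans (add_le_add (h5.trans ih) (he l hl'))
  have hfin := main net.L le_rfl
  have hs1 : suf net.L = 1 := by simp [hsuf]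
  rw [hs1, mul_one] at hfin
  nlinarith

end ConvNet

/-! ### Elementary estimates for the weights -/

theorem succ_mul_succ_succ_le_two_pow (j : ℕ) : (j + 1) * (j + 2) ≤ 3 * 2 ^ j := by
  induction j with
  | zero => norm_num
  | succ j ih =>
    rcases Nat.lt_or_ge j 2 with h | h
    · interval_cases j <;> norm_num
    · rw [pow_succ]; nlinarith

theorem one_div_le_intWeight (e : ℤ) {Q : ℝ} (hQ : (2 : ℝ) ^ e.natAbs ≤ Q) :
    1 / (6 * Q) ≤ intWeight e := by
  have h := succ_mul_succ_succ_le_two_pow e.natAbs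
  have h' : ((e.natAbs : ℝ) + 1) * (e.natAbs + 2) ≤ 3 * 2 ^ e.natAbs := by exact_mod_cast h
  rw [intWeight, natWeight]
  have : 1 / (6 * Q) ≤ 1 / (2 * (((e.natAbs : ℝ) + 1) * (e.natAbs + 2))) :=
    one_div_le_one_div_of_le (by positivity) (by linarith)
  refine this.trans (le_of_eq ?_)
  field_simp

theorem exp_neg_le_layerWeight {α : Type*} [Fintype α] [Nonempty α] (c : List α × ℤ) {Q D H : ℝ}
    (k : ℕ) (hlen : c.1.length ≤ k) (h0 : c.1 = [] → c.2 = 0) (hQ : 1 ≤ Q) (hD : 1 ≤ D)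
    (hw : c.1 ≠ [] → 1 / (Q * D) ≤ intWeight c.2) (hH : Real.log (2 * Fintype.card α * Q) ≤ H) :
    Real.exp (-(Real.log 2 + Real.log D + k * H)) ≤ layerWeight c := by
  have hN : (1 : ℝ) ≤ Fintype.card α := by exact_mod_cast Fintype.card_pos
  have hpos : 0 < 2 * (Fintype.card α : ℝ) * Q := by positivity
  have hH0 : 0 ≤ H := (Real.log_nonneg (by nlinarith)).trans hH
  have hexp : Real.exp (-(Real.log 2 + Real.log D + k * H)) =
      1 / 2 * (1 / D) * Real.exp (-(k * H)) := by
    rw [neg_add, neg_add, Real.exp_add, Real.exp_add, ← Real.log_inv, ← Real.log_inv,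
      Real.exp_log (by norm_num), Real.exp_log (by positivity)]
    simp
  rw [hexp]
  by_cases h : c.1 = []
  · have : layerWeight c = 1 / 2 := by simp [layerWeight, h, h0 h, listWeight]
    rw [this]
    have h1 : 1 / D ≤ 1 := by rw [div_le_one (by linarith)]; exact hD
    have h2 : Real.exp (-(k * H)) ≤ 1 := by
      rw [Real.exp_le_one_iff]; have : 0 ≤ (k : ℝ) * H := by positivity
      linarith
    have h3 : 0 ≤ 1 / D := by positivity
    nlinarith [Real.exp_pos (-(k * H))]
  · have hw := hw h
    have hl : 1 ≤ c.1.length := List.length_pos_iff.2 h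
    have : layerWeight c = 1 / 2 * (1 / (2 * Fintype.card α)) ^ c.1.length * intWeight c.2 := by
      simp [layerWeight, h, listWeight]
    rw [this]
    have h1 : Real.exp (-(k * H)) ≤ (1 / (2 * Fintype.card α * Q)) ^ c.1.length := by
      have e1 : (1 / (2 * Fintype.card α * Q)) ^ c.1.length =
          Real.exp (-(c.1.length * Real.log (2 * Fintype.card α * Q))) := by
        rw [← mul_neg, Real.exp_nat_mul, ← Real.log_inv, Real.exp_log (by positivity), one_div]
      rw [e1]
      refine Real.exp_le_exp.2 (neg_le_neg ?_)
      exact mul_le_mul (by exact_mod_cast hlen) hH (Real.log_nonneg (by nlinarith)) (by positivity)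
    have h2 : (1 / (2 * Fintype.card α * Q)) ^ c.1.length ≤
        (1 / (2 * (Fintype.card α : ℝ))) ^ c.1.length * (1 / Q) := by
      have e1 : 1 / (2 * Fintype.card α * Q) = (1 / (2 * (Fintype.card α : ℝ))) * (1 / Q) := by
        field_simp
      rw [e1, mul_pow]
      refine mul_le_mul_of_nonneg_left ?_ (by positivity)
      exact pow_le_of_le_one (by positivity) (by rw [div_le_one (by linarith)]; exact hQ)
        (by omega)
    calc 1 / 2 * (1 / D) * Real.exp (-(k * H))
        ≤ 1 / 2 * (1 / D) * ((1 / (2 * (Fintype.card α : ℝ))) ^ c.1.length * (1 / Q)) := by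
          gcongr; exact h1.trans h2
      _ = 1 / 2 * (1 / (2 * (Fintype.card α : ℝ))) ^ c.1.length * (1 / (Q * D)) := by
          field_simp
      _ ≤ _ := by gcongr

namespace ConvNet

variable (net : ConvNet)

/-! ### Codes of networks with input radius and margin -/

/-- A code: input radius, margin scale, and the updates of each layer. -/
abbrev Code (n : ℕ) : Type := ℕ × ℤ × ((l : Fin net.L) → List (net.Upd n l) × ℤ)

/-- Weight of a code. -/
noncomputable def codeWeight {n : ℕ} (c : net.Code n) : ℝ :=
  natWeight c.1 * (intWeight c.2.1 * ∏ l, layerWeight (c.2.2 l))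

theorem subProb_codeWeight (n : ℕ) : SubProb (net.codeWeight (n := n)) :=
  subProb_natWeight.mul_dep (g := fun _ (c : ℤ × ((l : Fin net.L) → List (net.Upd n l) × ℤ)) =>
      intWeight c.1 * ∏ l, layerWeight (c.2 l)) fun _ =>
    subProb_intWeight.mul_dep (g := fun _ (c : (l : Fin net.L) → List (net.Upd n l) × ℤ) =>
      ∏ l, layerWeight (c l)) fun _ => SubProb.pi fun _ => subProb_layerWeight

/-- Extend the updates of the layers of the network to all indices. -/
def extendCode {n : ℕ} (c : (l : Fin net.L) → List (net.Upd n l) × ℤ) (l : ℕ) :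
    List (net.Upd n l) × ℤ :=
  if h : l < net.L then c ⟨l, h⟩ else ([], 0)

theorem codeAct_congr {n : ℕ} (M : ∀ l, net.Wt l) (z : Fin n × Bool → net.Act 0)
    (c c' : ∀ l, List (net.Upd n l) × ℤ) (h : ∀ l < net.L, c l = c' l) (l : ℕ) (hl : l ≤ net.L) :
    net.codeAct M z c l = net.codeAct M z c' l := by
  induction l with
  | zero => rfl
  | succ l ih => ext1 p; rw [codeAct, codeAct, ih (Nat.le_of_succ_le hl), h l hl]

/-- The value of class `c` in an output activation. -/
def outScore (v : net.Act net.L) (c : Fin net.K) : ℝ :=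
  v c ⟨0, by rw [net.w_last]; exact Nat.one_pos⟩

theorem abs_outScore_sub_le (v v' : net.Act net.L) (c : Fin net.K) :
    |net.outScore v c - net.outScore v' c| ≤ ‖v - v'‖ :=
  (norm_le_pi_norm ((v - v') c) _).trans (norm_le_pi_norm (v - v') c)

/-- Points that are far from the origin or whose margin is less than `t`. -/
def lowMargin (N₀ : Seminorm ℝ (net.Act 0)) (A : ∀ l, net.Wt l) (x₀ t : ℝ) :
    Set (net.Act 0 × Fin net.K) :=
  {q | x₀ < N₀ q.1 ∨ ∃ c, c ≠ q.2 ∧ net.score A q.1 q.2 - net.score A q.1 c < t}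

/-- Points close to the origin whose margin is more than `t`. -/
def highMargin (N₀ : Seminorm ℝ (net.Act 0)) (A : ∀ l, net.Wt l) (x₀ t : ℝ) :
    Set (net.Act 0 × Fin net.K) :=
  {q | N₀ q.1 < x₀ ∧ ∀ c, c ≠ q.2 → t < net.score A q.1 q.2 - net.score A q.1 c}

/-- The points of the double sample that the network described by a code classifies with low
margin; `rs` is the unit of the margin scale. -/
def codeSet {n : ℕ} (N₀ : Seminorm ℝ (net.Act 0)) (M : ∀ l, net.Wt l) (rs : ℝ)
    (z : Fin n → (net.Act 0 × Fin net.K) × (net.Act 0 × Fin net.K)) (c : net.Code n) :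
    Set (Fin n × Bool) :=
  {p | 2 ^ c.1 < N₀ (samplePt z p).1 ∨ ∃ k, k ≠ (samplePt z p).2 ∧
    net.outScore (net.codeAct M (fun p => (samplePt z p).1) (net.extendCode c.2.2) net.L p)
        (samplePt z p).2 -
      net.outScore (net.codeAct M (fun p => (samplePt z p).1) (net.extendCode c.2.2) net.L p) k <
    3 / 5 * (2 ^ c.2.1 * rs)}

theorem separates_codeSet {n : ℕ} (normA : ∀ l, Seminorm ℝ (net.Act l))
    (hout : ∀ x : net.Act net.L, ‖x‖ ≤ normA net.L x) (M A : ∀ l, net.Wt l) (rs : ℝ)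
    (z : Fin n → (net.Act 0 × Fin net.K) × (net.Act 0 × Fin net.K)) (c : net.Code n)
    (hc : ∀ p, normA 0 (samplePt z p).1 ≤ 2 ^ c.1 →
      normA net.L (net.F A net.L (samplePt z p).1 -
        net.codeAct M (fun p => (samplePt z p).1) (net.extendCode c.2.2) net.L p) ≤
        2 ^ c.2.1 * rs / 5) :
    Separates (net.codeSet (normA 0) M rs) z c
      (net.lowMargin (normA 0) A (2 ^ c.1) (2 ^ c.2.1 * rs / 5))
      (net.highMargin (normA 0) A (2 ^ c.1) (2 ^ c.2.1 * rs)) := by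
  intro p
  set q := samplePt z p with hq
  set v := net.codeAct M (fun p => (samplePt z p).1) (net.extendCode c.2.2) net.L p with hv
  set γ : ℝ := 2 ^ c.2.1 * rs with hγ
  have hclose : normA 0 q.1 ≤ 2 ^ c.1 → ∀ k, |net.score A q.1 k - net.outScore v k| ≤ γ / 5 :=
    fun h k => (net.abs_outScore_sub_le (net.F A net.L q.1) v k).trans
      ((hout _).trans (hc p h))
  constructor
  · rintro (hlt | ⟨k, hk, hlt⟩)
    · exact Or.inl hlt
    · rcases lt_or_ge (2 ^ c.1) (normA 0 q.1) with h | h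
      · exact Or.inl h
      · refine Or.inr ⟨k, hk, ?_⟩
        have h1 := abs_le.1 (hclose h k)
        have h2 := abs_le.1 (hclose h q.2)
        linarith
  · rintro ⟨hlt, hm⟩ (h | ⟨k, hk, h⟩)
    · exact absurd hlt (not_lt.2 h.le)
    · have h1 := abs_le.1 (hclose hlt.le k)
      have h2 := abs_le.1 (hclose hlt.le q.2)
      have h3 := hm k hk
      linarith

theorem continuous_F (ρ : ℕ → ℝ≥0) (hG : ∀ l < net.L, LipschitzWith (ρ (l + 1)) (net.G l))
    (A : ∀ l, net.Wt l) (l : ℕ) (hl : l ≤ net.L) : Continuous (net.F A l) := by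
  induction l with
  | zero => exact continuous_id
  | succ l ih =>
    have h1 := ih (Nat.le_of_succ_le hl)
    have h2 : Continuous fun x => net.conv l (A l) x := by unfold conv; fun_prop
    exact (hG l hl).continuous.comp (h2.comp h1)

theorem continuous_score (ρ : ℕ → ℝ≥0) (hG : ∀ l < net.L, LipschitzWith (ρ (l + 1)) (net.G l))
    (A : ∀ l, net.Wt l) (c : Fin net.K) : Continuous fun x => net.score A x c := by
  have := net.continuous_F ρ hG A net.L le_rfl
  unfold score
  fun_prop

end ConvNet

theorem Seminorm.continuous_pi_pi {a b : ℕ} (N : Seminorm ℝ (Fin a → Fin b → ℝ)) :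
    Continuous N :=
  N.convexOn.locallyLipschitz.continuous

namespace ConvNet
variable (net : ConvNet)

theorem isOpen_of_forall_slice {α β : Type*} [TopologicalSpace α] [TopologicalSpace β]
    [DiscreteTopology β] {s : Set (α × β)} (h : ∀ b, IsOpen {a | (a, b) ∈ s}) : IsOpen s := by
  rw [isOpen_iff_mem_nhds]
  rintro ⟨a, b⟩ hab
  rw [nhds_prod_eq, nhds_discrete β, Filter.prod_pure]
  exact Filter.mem_map.2 ((h b).mem_nhds hab)

theorem isOpen_lowMargin (ρ : ℕ → ℝ≥0) (hG : ∀ l < net.L, LipschitzWith (ρ (l + 1)) (net.G l))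
    (N₀ : Seminorm ℝ (net.Act 0)) (A : ∀ l, net.Wt l) (x₀ t : ℝ) :
    IsOpen (net.lowMargin N₀ A x₀ t) := by
  refine isOpen_of_forall_slice fun y => ?_
  have hs := net.continuous_score ρ hG A
  have : {x | (x, y) ∈ net.lowMargin N₀ A x₀ t} =
      {x | x₀ < N₀ x} ∪ ⋃ (c : Fin net.K) (_ : c ≠ y), {x | net.score A x y - net.score A x c < t} := by
    ext x; simp [lowMargin]
  rw [this]
  exact (isOpen_lt continuous_const N₀.continuous_pi_pi).union
    (isOpen_iUnion fun c => isOpen_iUnion fun _ => isOpen_lt ((hs y).sub (hs c)) continuous_const)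

theorem isOpen_highMargin (ρ : ℕ → ℝ≥0) (hG : ∀ l < net.L, LipschitzWith (ρ (l + 1)) (net.G l))
    (N₀ : Seminorm ℝ (net.Act 0)) (A : ∀ l, net.Wt l) (x₀ t : ℝ) :
    IsOpen (net.highMargin N₀ A x₀ t) := by
  refine isOpen_of_forall_slice fun y => ?_
  have hs := net.continuous_score ρ hG A
  have : {x | (x, y) ∈ net.highMargin N₀ A x₀ t} =
      {x | N₀ x < x₀} ∩ ⋂ (c : Fin net.K) (_ : c ≠ y), {x | t < net.score A x y - net.score A x c} := by
    ext x; simp [highMargin]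
  rw [this]
  refine (isOpen_lt N₀.continuous_pi_pi continuous_const).inter ?_
  exact isOpen_iInter_of_finite fun c => isOpen_iInter_of_finite fun _ =>
    isOpen_lt continuous_const ((hs y).sub (hs c))

end ConvNet

/-! ### Choice of the radius, of the scales, and their costs -/

theorem exists_radius {X : ℝ} (hX : 0 ≤ X) :
    ∃ j : ℕ, X < 2 ^ j ∧ (2 : ℝ) ^ j ≤ 2 * (X + 1) ∧ ((j : ℝ) + 1) * (j + 2) ≤ (2 + X) ^ 2 := by
  rcases lt_or_ge X 1 with h | h
  · exact ⟨0, by simpa using h, by norm_num; linarith, by norm_num; nlinarith⟩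
  · obtain ⟨j, hj1, hj2⟩ := exists_nat_pow_near h (one_lt_two (α := ℝ))
    refine ⟨j + 1, hj2, by rw [pow_succ]; linarith, ?_⟩
    have h1 : ((j + 1 : ℕ) + 1 : ℝ) * ((j + 1 : ℕ) + 2) ≤ 3 * 2 ^ (j + 1) := by
      exact_mod_cast succ_mul_succ_succ_le_two_pow (j + 1)
    refine h1.trans ?_
    rw [pow_succ]
    nlinarith [sq_nonneg (X - 1)]

theorem log_le_div_of_pos {y : ℝ} (hy : 0 < y) : Real.log y ≤ y / 2.7 := by
  have h1 := Real.log_le_sub_one_of_pos (x := y / 2.7) (by positivity)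
  rw [Real.log_div hy.ne' (by norm_num)] at h1
  have h2 : Real.log 2.7 ≤ 1 := by
    rw [Real.log_le_iff_le_exp (by norm_num)]
    linarith [Real.exp_one_gt_d9]
  linarith

theorem log_nat_le {L : ℕ} (hL : 1 ≤ L) : Real.log L ≤ (L - 1) * Real.log 2 := by
  have h : L ≤ 2 ^ (L - 1) := by
    have := Nat.lt_two_pow_self (n := L - 1); omega
  have h1 : Real.log L ≤ Real.log ((2 : ℝ) ^ (L - 1)) :=
    Real.log_le_log (by positivity) (by exact_mod_cast h)
  rw [Real.log_pow, Nat.cast_sub hL] at h1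
  simpa using h1

theorem log_intCost_le {L : ℕ} (hL : 1 ≤ L) {S ζ t : ℝ} (hS : 3 * L * Real.log 2 ≤ S) (hζ : 0 ≤ ζ)
    (ht : 0 ≤ t)
    (h : t * Real.log 2 ≤ Real.log 2 + (3 + L) * Real.log L + S + ζ * Real.log 2) :
    Real.log (2 * ((t + 1) * (t + 2))) ≤ 5 / 2 * S + 2 * ζ := by
  have hl2 := Real.log_two_gt_d9
  have hl2' : 0 < Real.log 2 := by linarith
  have hL' : (1 : ℝ) ≤ L := by exact_mod_cast hL
  set Y := S / Real.log 2 with hY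
  have hSY : S = Y * Real.log 2 := by rw [hY]; field_simp
  have hYL : 3 * L ≤ Y := by rw [hY, le_div_iff₀ hl2']; exact hS
  have hY3 : 3 ≤ Y := by linarith
  have ht1 : t ≤ 1 + (3 + L) * (L - 1) + Y + ζ := by
    have h1 : (3 + L) * Real.log L ≤ (3 + L) * ((L - 1) * Real.log 2) :=
      mul_le_mul_of_nonneg_left (log_nat_le hL) (by positivity)
    have h2 : t * Real.log 2 ≤ (1 + (3 + L) * (L - 1) + Y + ζ) * Real.log 2 := by
      rw [hSY] at h; linarith
    exact le_of_mul_le_mul_right h2 hl2'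
  have ht2 : t + 2 ≤ 2 / 3 * Y ^ 2 * (1 + ζ) := by
    have h1 : (3 + (L : ℝ)) * (L - 1) ≤ Y ^ 2 / 9 + 2 * Y / 3 - 3 := by nlinarith
    have h2 : 3 + Y + (3 + (L : ℝ)) * (L - 1) ≤ 2 / 3 * Y ^ 2 := by nlinarith
    have h3 : 1 ≤ 2 / 3 * Y ^ 2 := by nlinarith
    nlinarith
  have h4 : 2 * ((t + 1) * (t + 2)) ≤ Y ^ 4 * (1 + ζ) ^ 2 := by
    have : (t + 2) ^ 2 ≤ (2 / 3 * Y ^ 2 * (1 + ζ)) ^ 2 := pow_le_pow_left₀ (by linarith) ht2 2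
    have h0 : 0 ≤ Y ^ 4 * (1 + ζ) ^ 2 := by positivity
    nlinarith
  have hYp : 0 < Y := by linarith
  have h5 := Real.log_le_log (by positivity) h4
  rw [Real.log_mul (x := Y ^ 4) (by positivity) (by positivity), Real.log_pow, Real.log_pow] at h5
  have h6 := log_le_div_of_pos hYp
  have h7 := Real.log_le_sub_one_of_pos (x := 1 + ζ) (by linarith)
  push_cast at h5
  have h8 : 4 * (Y / 2.7) ≤ 5 / 2 * (Y * 0.6931) := by
    rw [← sub_nonneg]
    have : 5 / 2 * (Y * 0.6931) - 4 * (Y / 2.7) = Y * (5 / 2 * 0.6931 - 4 / 2.7) := by ring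
    rw [this]
    exact mul_nonneg hYp.le (by norm_num)
  have h9 : Y * 0.6931 ≤ Y * Real.log 2 := mul_le_mul_of_nonneg_left (by linarith) hYp.le
  rw [hSY]
  linarith

theorem two_pow_natAbs_le {n L : ℕ} (hL : 1 ≤ L) (hLn : L ≤ n) (hn : 2 ≤ n) {a d : ℝ} (ha : 0 ≤ a)
    (had : a ≤ d) {e : ℤ} (h1 : ((2 : ℝ) ^ e) ^ 2 ≤ (2 * a) ^ 2)
    (h2 : (2 * (a + 1 / L)) ^ 2 ≤ n * ((2 : ℝ) ^ e) ^ 2) :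
    (2 : ℝ) ^ e.natAbs ≤ n ^ 2 * (2 + d / L) := by
  have hL' : (1 : ℝ) ≤ L := by exact_mod_cast hL
  have hLn' : (L : ℝ) ≤ n := by exact_mod_cast hLn
  have hn' : (2 : ℝ) ≤ n := by exact_mod_cast hn
  have hd : 0 ≤ d := ha.trans had
  have hep : (0 : ℝ) < 2 ^ e := by positivity
  have hdL : 0 ≤ d / L := by positivity
  rcases le_or_gt 0 e with he | he
  · have e1 : (2 : ℝ) ^ e.natAbs = 2 ^ e := by
      rw [← zpow_natCast, Int.natCast_natAbs, abs_of_nonneg he]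
    rw [e1]
    have h3 : (2 : ℝ) ^ e ≤ 2 * a := le_of_sq_le_sq h1 (by linarith)
    have h4 : d = L * (d / L) := by field_simp
    have h5 : (L : ℝ) * (d / L) ≤ n * (d / L) := by gcongr
    have h6 : (2 : ℝ) * (n * (d / L)) ≤ n * (n * (d / L)) := by gcongr
    nlinarith
  · have e1 : (2 : ℝ) ^ e.natAbs * 2 ^ e = 1 := by
      rw [← zpow_natCast, Int.natCast_natAbs, abs_of_neg he, ← zpow_add₀ (by norm_num)]
      simp
    set g : ℝ := 2 ^ e.natAbs with hg
    have hg0 : 0 < g := by positivity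
    have hL1 : 1 / (L : ℝ) * L = 1 := by field_simp
    have h3 : (2 * (1 / (L : ℝ))) ^ 2 ≤ n * ((2 : ℝ) ^ e) ^ 2 := by
      refine le_trans (pow_le_pow_left₀ (by positivity) ?_ 2) h2
      linarith
    have h4 : 4 * g ^ 2 ≤ n * L ^ 2 := by
      have h5 : (2 * (1 / (L : ℝ))) ^ 2 * (g ^ 2 * L ^ 2) ≤ n * ((2 : ℝ) ^ e) ^ 2 * (g ^ 2 * L ^ 2) := by
        gcongr
      have h6 : (2 * (1 / (L : ℝ))) ^ 2 * (g ^ 2 * L ^ 2) = 4 * g ^ 2 * (1 / (L : ℝ) * L) ^ 2 := by ring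
      have h7 : n * ((2 : ℝ) ^ e) ^ 2 * (g ^ 2 * L ^ 2) = n * L ^ 2 * (g * 2 ^ e) ^ 2 := by ring
      rw [h6, h7, hL1, e1] at h5
      linarith
    have h8 : g ^ 2 ≤ ((n : ℝ) ^ 2) ^ 2 := by
      have h9 : (n : ℝ) * L ^ 2 ≤ n * n ^ 2 := by gcongr
      have h10 : (n : ℝ) ^ 3 * 1 ≤ n ^ 3 * n := by gcongr; linarith
      nlinarith [sq_nonneg g]
    have h11 : g ≤ n ^ 2 := le_of_sq_le_sq h8 (by positivity)
    nlinarith [sq_nonneg (n : ℝ)]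

theorem two_le_log {n : ℕ} (hn : 9 ≤ n) : 2 ≤ Real.log n := by
  have h9 : (9 : ℝ) ≤ n := by exact_mod_cast hn
  rw [Real.le_log_iff_exp_le (by linarith)]
  have h1 := Real.exp_one_lt_d9
  have h2 : Real.exp 2 = Real.exp 1 ^ 2 := by rw [← Real.exp_nat_mul]; norm_num
  rw [h2]
  nlinarith [Real.exp_pos 1]

theorem scale_budget {R Λ b g : ℝ} (hR : 1 ≤ 256 * R) (hb : b + 2 ≤ Λ) (hΛ : 4 ≤ Λ) (hg : 2 ≤ g) :
    2 * (4 * Λ * (25600 * R ^ 2) + 2 * (8 + b)) ≤ (1536 * R * g) ^ 2 * Λ := by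
  have h1 : (4 : ℝ) ≤ g ^ 2 := by nlinarith
  have h2 : (1 : ℝ) ≤ 65536 * R ^ 2 := by nlinarith
  have h4 : 0 ≤ R ^ 2 * Λ := by positivity
  have h5 : Λ ≤ 65536 * (R ^ 2 * Λ) := by
    have := mul_le_mul_of_nonneg_right h2 (by linarith : 0 ≤ Λ)
    linarith
  have h6 : 2359296 * (R ^ 2 * Λ) * 4 ≤ 2359296 * (R ^ 2 * Λ) * g ^ 2 :=
    mul_le_mul_of_nonneg_left h1 (by positivity)
  have h3 : (1536 * R * g) ^ 2 * Λ = 2359296 * (R ^ 2 * Λ) * g ^ 2 := by ring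
  have h7 : 4 * Λ * (25600 * R ^ 2) = 102400 * (R ^ 2 * Λ) := by ring
  rw [h3, h7]
  linarith

/-- Choice of a dyadic margin `γ' = 2 ^ j * (128 r)` that can be described cheaply.  `κ` bounds the
total number of updates. -/
theorem exists_margin_scale {n L : ℕ} (hn : 9 ≤ n) (hL : 1 ≤ L) {S T γ r Λ : ℝ}
    (hΛ : Real.logb 2 (7 * n) ≤ Λ) (hγ : 0 < γ) (hT : 0 < T) (hr : 0 < r)
    (hlow : r ≤ T * L ^ L) (hup : T ≤ L ^ (3 + L) * Real.exp S * r)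
    (hR : 25600 * (T / γ) ^ 2 ≤ n) (hS : 3 * L * Real.log 2 ≤ S) :
    ∃ (j : ℤ) (c κ : ℝ), 2 ^ j * (128 * r) ≤ γ ∧ 6400 * (T / (2 ^ j * (128 * r))) ^ 2 ≤ n ∧
      0 ≤ c ∧ 0 ≤ κ ∧
      Real.log (2 * (((j.natAbs : ℝ) + 1) * (j.natAbs + 2))) ≤ 5 / 2 * S + c ∧
      (6400 * (T / (2 ^ j * (128 * r))) ^ 2 < 1 ∨ 6400 * (T / (2 ^ j * (128 * r))) ^ 2 ≤ κ) ∧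
      2 * (4 * Λ * κ + c) ≤ (1536 * (T / γ) * Real.log n) ^ 2 * Λ := by
  have hl2 := Real.log_two_gt_d9
  have hl2u := Real.log_two_lt_d9
  have hl2' : 0 < Real.log 2 := by linarith
  have hL' : (1 : ℝ) ≤ L := by exact_mod_cast hL
  have hn' : (9 : ℝ) ≤ n := by exact_mod_cast hn
  have hlogL : 0 ≤ Real.log L := Real.log_nonneg hL'
  have hlogn := two_le_log hn
  have hS0 : 0 ≤ S := le_trans (by positivity) hS
  have hlogb : Real.log n / Real.log 2 + 2 ≤ Λ := by
    refine le_trans ?_ hΛ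
    rw [Real.logb, Real.log_mul (by norm_num) (by positivity), add_div, add_comm]
    have : 2 ≤ Real.log 7 / Real.log 2 := by
      rw [le_div_iff₀ hl2']
      have h4 : (2 : ℝ) * Real.log 2 = Real.log 4 := by
        rw [show (4 : ℝ) = 2 ^ 2 by norm_num, Real.log_pow]; norm_num
      rw [h4]; exact Real.log_le_log (by norm_num) (by norm_num)
    linarith
  have hΛ4 : 4 ≤ Λ := by
    have : 2 ≤ Real.log n / Real.log 2 := by
      rw [le_div_iff₀ hl2']; linarith
    linarith
  set γ₀ := min γ (256 * T) with hγ₀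
  have hγ₀p : 0 < γ₀ := lt_min hγ (by positivity)
  obtain ⟨j, hj1, hj2⟩ := exists_mem_Ico_zpow (x := γ₀ / (128 * r)) (y := (2 : ℝ)) (by positivity)
    one_lt_two
  rw [le_div_iff₀ (by positivity)] at hj1
  rw [div_lt_iff₀ (by positivity), zpow_add_one₀ (by norm_num)] at hj2
  set g : ℝ := 2 ^ j with hg
  have hg0 : 0 < g := by positivity
  have hγ'γ : g * (128 * r) ≤ γ := hj1.trans (min_le_left _ _)
  have hγ'T : g * (128 * r) ≤ 256 * T := hj1.trans (min_le_right _ _)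
  have hγ'0 : 0 < g * (128 * r) := by positivity
  have hupj : Real.log g ≤ Real.log 2 + (3 + L) * Real.log L + S := by
    have h1 : g ≤ 2 * (L ^ (3 + L) * Real.exp S) := by
      have : g * r ≤ 2 * (L ^ (3 + L) * Real.exp S) * r := by linarith
      exact le_of_mul_le_mul_right this hr
    have h2 := Real.log_le_log hg0 h1
    rw [Real.log_mul (by norm_num) (by positivity), Real.log_mul (by positivity) (by positivity),
      Real.log_pow, Real.log_exp] at h2
    push_cast at h2
    linarith
  have hlogg : Real.log g = j * Real.log 2 := by rw [hg, Real.log_zpow]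
  have habs : ∀ ζ : ℝ, 0 ≤ ζ → -Real.log g ≤ L * Real.log L + ζ * Real.log 2 →
      Real.log (2 * (((j.natAbs : ℝ) + 1) * (j.natAbs + 2))) ≤ 5 / 2 * S + 2 * ζ := by
    intro ζ hζ hlo
    refine log_intCost_le hL hS hζ (by positivity) ?_
    have hna : (j.natAbs : ℝ) = |(j : ℝ)| := by rw [Nat.cast_natAbs]; simp
    rw [hna]
    rcases abs_cases (j : ℝ) with ⟨h, _⟩ | ⟨h, _⟩
    · rw [h, ← hlogg]
      have : 0 ≤ ζ * Real.log 2 := by positivity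
      linarith
    · rw [h, neg_mul, ← hlogg]
      linarith
  have hTr : -(L * Real.log L) ≤ Real.log (T / r) := by
    have h1 : (1 : ℝ) / L ^ L ≤ T / r := by
      rw [div_le_div_iff₀ (by positivity) hr]; linarith
    have h2 := Real.log_le_log (by positivity) h1
    rw [one_div, Real.log_inv, Real.log_pow] at h2
    exact h2
  have hRpos : 0 < T / γ := by positivity
  rcases le_total γ (256 * T) with hcase | hcase
  · -- the margin is not large compared with the capacity
    have hγ₀' : γ₀ = γ := min_eq_left hcase
    rw [hγ₀'] at hj2
    have hR1 : 1 ≤ 256 * (T / γ) := by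
      rw [← mul_div_assoc, le_div_iff₀ hγ]; linarith
    have hRn : T / γ ≤ n := by
      have : 256 * (T / γ) ≤ 256 * (T / γ) * (256 * (T / γ)) :=
        le_mul_of_one_le_right (by positivity) hR1
      nlinarith
    have hζ0 : 0 ≤ 8 + Real.log n / Real.log 2 := by positivity
    have hκ : 6400 * (T / (g * (128 * r))) ^ 2 ≤ 25600 * (T / γ) ^ 2 := by
      have h1 : T / (g * (128 * r)) ≤ 2 * (T / γ) := by
        rw [← mul_div_assoc, div_le_div_iff₀ hγ'0 hγ]
        have := mul_le_mul_of_nonneg_left hj2.le hT.le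
        linarith
      have h2 : (T / (g * (128 * r))) ^ 2 ≤ (2 * (T / γ)) ^ 2 :=
        pow_le_pow_left₀ (by positivity) h1 2
      linarith
    refine ⟨j, 2 * (8 + Real.log n / Real.log 2), 25600 * (T / γ) ^ 2, hγ'γ, hκ.trans hR,
      by positivity, by positivity, ?_, Or.inr hκ, ?_⟩
    · refine habs _ hζ0 ?_
      have h1 : T / r / (256 * n) ≤ g := by
        rw [div_div, div_le_iff₀ (by positivity)]
        have : T ≤ n * γ := by rwa [div_le_iff₀ hγ] at hRn
        have := mul_le_mul_of_nonneg_left hj2.le (by positivity : (0 : ℝ) ≤ n)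
        linarith
      have h2 := Real.log_le_log (by positivity) h1
      rw [Real.log_div (by positivity) (by positivity), Real.log_mul (by norm_num) (by positivity)]
        at h2
      have h3 : Real.log 256 = 8 * Real.log 2 := by
        rw [show (256 : ℝ) = 2 ^ 8 by norm_num, Real.log_pow]; norm_num
      have h4 : (8 + Real.log n / Real.log 2) * Real.log 2 = 8 * Real.log 2 + Real.log n := by
        field_simp
      rw [h4]; linarith
    · exact scale_budget hR1 hlogb hΛ4 hlogn
  · have hγ₀' : γ₀ = 256 * T := min_eq_right hcase
    rw [hγ₀'] at hj2
    have h1 : 6400 * (T / (g * (128 * r))) ^ 2 < 1 := by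
      have h1 : T / (g * (128 * r)) ≤ 1 / 128 := by
        rw [div_le_div_iff₀ hγ'0 (by norm_num)]; linarith
      have h2 : (T / (g * (128 * r))) ^ 2 ≤ (1 / 128) ^ 2 := pow_le_pow_left₀ (by positivity) h1 2
      norm_num at h2 ⊢
      linarith
    refine ⟨j, 0, 0, hγ'γ, by linarith, le_rfl, le_rfl, ?_, Or.inl h1, ?_⟩
    · have := habs 0 le_rfl ?_
      · simpa using this
      · have h2 : T / r ≤ g := by
          rw [div_le_iff₀ hr]; linarith
        have h3 := Real.log_le_log (by positivity) h2
        linarith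
    · have : 0 ≤ (1536 * (T / γ) * Real.log n) ^ 2 * Λ := by positivity
      linarith

namespace ConvNet

variable (net : ConvNet)

/-! ### Description of a network with a given capacity -/

/-- The contribution of layer `l` to the capacity, before division by the margin. -/
noncomputable def capTerm (normW : ∀ l, Seminorm ℝ (net.Wt l)) (a : ∀ l, net.Wt l → ℝ) (r : ℕ → ℝ)
    (A : ∀ l, net.Wt l) (X : ℝ) (l : ℕ) : ℝ :=
  (X + 1) * ((a l (A l) + 1 / (net.L : ℝ)) * r l * net.prodExcept normW A l)

/-- The logarithmic complexity of the parameters. -/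
noncomputable def logTerm (normW : ∀ l, Seminorm ℝ (net.Wt l)) (M A : ∀ l, net.Wt l) (X : ℝ) : ℝ :=
  ∑ l ∈ Finset.range net.L, (Real.log (2 + X) + Real.log (2 + net.dist21 l (A l) (M l) / net.L) +
    Real.log (2 + normW l (A l) / net.L))

theorem one_le_L : (1 : ℝ) ≤ net.L := by exact_mod_cast net.L_pos

theorem prodExcept_eq (normW : ∀ l, Seminorm ℝ (net.Wt l)) (A : ∀ l, net.Wt l) {l : ℕ}
    (hl : l < net.L) : net.prodExcept normW A l =
      (∏ i ∈ Finset.range l, (normW i (A i) + 1 / (net.L : ℝ))) *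
        ∏ i ∈ Finset.Ico (l + 1) net.L, (normW i (A i) + 1 / (net.L : ℝ)) := by
  have hL := net.one_le_L
  set β : ℕ → ℝ := fun i => normW i (A i) + 1 / (net.L : ℝ) with hβ
  have hβ0 : 0 < β l := add_pos_of_nonneg_of_pos (apply_nonneg _ _) (by positivity)
  have h1 : β l * net.prodExcept normW A l = ∏ i ∈ Finset.range net.L, β i :=
    Finset.mul_prod_erase _ β (Finset.mem_range.2 hl)
  have h2 := Finset.prod_range_mul_prod_Ico β hl.le
  rw [Finset.prod_eq_prod_Ico_succ_bot hl] at h2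
  refine mul_left_cancel₀ hβ0.ne' ?_
  rw [h1, ← h2]
  ring

theorem prodExcept_pos (normW : ∀ l, Seminorm ℝ (net.Wt l)) (A : ∀ l, net.Wt l) (l : ℕ) :
    0 < net.prodExcept normW A l := by
  have hL := net.one_le_L
  exact Finset.prod_pos fun i _ => add_pos_of_nonneg_of_pos (apply_nonneg _ _) (by positivity)

theorem three_mul_le_logTerm (normW : ∀ l, Seminorm ℝ (net.Wt l)) (M A : ∀ l, net.Wt l) {X : ℝ}
    (hX : 0 ≤ X) : 3 * net.L * Real.log 2 ≤ net.logTerm normW M A X := by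
  have hle : ∀ t : ℝ, 0 ≤ t → Real.log 2 ≤ Real.log (2 + t) := fun t ht =>
    Real.log_le_log (by norm_num) (by linarith)
  have : 3 * net.L * Real.log 2 = ∑ _l ∈ Finset.range net.L, (Real.log 2 + Real.log 2 + Real.log 2) := by
    rw [Finset.sum_const, Finset.card_range, nsmul_eq_mul]; ring
  rw [this]
  refine Finset.sum_le_sum fun l _ => add_le_add (add_le_add (hle _ hX) (hle _ ?_)) (hle _ ?_)
  · exact div_nonneg (net.dist21_nonneg _ _ _) (by positivity)
  · exact div_nonneg (apply_nonneg _ _) (by positivity)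

theorem capTerm_le (normW : ∀ l, Seminorm ℝ (net.Wt l)) (M : ∀ l, net.Wt l)
    (a : ∀ l, net.Wt l → ℝ) (ha0 : ∀ l A, 0 ≤ a l A) (had : ∀ l A, a l A ≤ net.dist21 l A (M l))
    (r : ℕ → ℝ) (A : ∀ l, net.Wt l) {X : ℝ} (hX : 0 ≤ X) {l : ℕ} (hl : l < net.L) (hr : 0 ≤ r l) :
    net.capTerm normW a r A X l ≤ r l * (net.L ^ net.L * Real.exp (net.logTerm normW M A X)) := by
  have hL := net.one_le_L
  have hL1 : 1 / (net.L : ℝ) ≤ 1 := by rw [div_le_one (by linarith)]; exact hL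
  have hL0 : 0 < 1 / (net.L : ℝ) := by positivity
  set y : ℕ → ℝ := fun i => (2 + X) * (2 + net.dist21 i (A i) (M i) / net.L) *
    (2 + normW i (A i) / net.L) with hy
  have hd : ∀ i, 0 ≤ net.dist21 i (A i) (M i) / net.L := fun i =>
    div_nonneg (net.dist21_nonneg _ _ _) (by positivity)
  have hb : ∀ i, 0 ≤ normW i (A i) / net.L := fun i => div_nonneg (apply_nonneg _ _) (by positivity)
  have hexp : Real.exp (net.logTerm normW M A X) = ∏ i ∈ Finset.range net.L, y i := by
    rw [logTerm, Real.exp_sum]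
    refine Finset.prod_congr rfl fun i _ => ?_
    rw [Real.exp_add, Real.exp_add, Real.exp_log (by linarith), Real.exp_log (by linarith [hd i]),
      Real.exp_log (by linarith [hb i])]
  have hpow : (net.L : ℝ) ^ net.L * Real.exp (net.logTerm normW M A X) =
      ∏ i ∈ Finset.range net.L, (net.L * y i) := by
    rw [Finset.prod_mul_distrib, Finset.prod_const, Finset.card_range, hexp]
  rw [hpow, ← Finset.mul_prod_erase _ _ (Finset.mem_range.2 hl), capTerm]
  have h1 : (X + 1) * (a l (A l) + 1 / (net.L : ℝ)) ≤ net.L * y l := by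
    have e : net.L * (2 + net.dist21 l (A l) (M l) / net.L) = 2 * net.L + net.dist21 l (A l) (M l) := by
      field_simp
    have h2 : a l (A l) + 1 / (net.L : ℝ) ≤ net.L * (2 + net.dist21 l (A l) (M l) / net.L) := by
      rw [e]; linarith [had l (A l)]
    have h3 : (X + 1) * (a l (A l) + 1 / (net.L : ℝ)) ≤
        (2 + X) * (net.L * (2 + net.dist21 l (A l) (M l) / net.L)) := by
      refine mul_le_mul (by linarith) h2 (by linarith [ha0 l (A l)]) (by linarith)
    have h4 : 0 ≤ (2 + X) * (net.L * (2 + net.dist21 l (A l) (M l) / net.L)) := by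
      have := hd l; positivity
    have h5 : net.L * y l = (2 + X) * (net.L * (2 + net.dist21 l (A l) (M l) / net.L)) *
      (2 + normW l (A l) / net.L) := by rw [hy]; ring
    rw [h5]
    exact h3.trans (le_mul_of_one_le_right h4 (by linarith [hb l]))
  have h2 : net.prodExcept normW A l ≤ ∏ i ∈ (Finset.range net.L).erase l, (net.L * y i) := by
    refine Finset.prod_le_prod (fun i _ => add_nonneg (apply_nonneg _ _) hL0.le) fun i _ => ?_
    have e : net.L * (2 + normW i (A i) / net.L) = 2 * net.L + normW i (A i) := by field_simp
    have h3 : normW i (A i) + 1 / (net.L : ℝ) ≤ net.L * (2 + normW i (A i) / net.L) := by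
      rw [e]; linarith
    have h4 : net.L * y i = net.L * (2 + normW i (A i) / net.L) *
        ((2 + X) * (2 + net.dist21 i (A i) (M i) / net.L)) := by rw [hy]; ring
    rw [h4]
    refine h3.trans (le_mul_of_one_le_right (by have := hb i; positivity) ?_)
    nlinarith [hd i]
  have h0 : 0 ≤ (X + 1) * (a l (A l) + 1 / (net.L : ℝ)) :=
    mul_nonneg (by linarith) (by linarith [ha0 l (A l)])
  calc (X + 1) * ((a l (A l) + 1 / (net.L : ℝ)) * r l * net.prodExcept normW A l)
      = r l * ((X + 1) * (a l (A l) + 1 / (net.L : ℝ)) * net.prodExcept normW A l) := by ring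
    _ ≤ _ := mul_le_mul_of_nonneg_left (mul_le_mul h1 h2 (net.prodExcept_pos _ _ _).le
        (h0.trans h1)) hr

theorem le_capTerm (normW : ∀ l, Seminorm ℝ (net.Wt l))
    (a : ∀ l, net.Wt l → ℝ) (ha0 : ∀ l A, 0 ≤ a l A)
    (r : ℕ → ℝ) (A : ∀ l, net.Wt l) {X : ℝ} (hX : 0 ≤ X) {l : ℕ} (hl : l < net.L) (hr : 0 ≤ r l) :
    r l ≤ net.capTerm normW a r A X l * net.L ^ net.L := by
  have hL := net.one_le_L
  have hL0 : 0 < 1 / (net.L : ℝ) := by positivity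
  have h1 : (1 / (net.L : ℝ)) ^ net.L ≤ (a l (A l) + 1 / (net.L : ℝ)) * net.prodExcept normW A l := by
    have e : (1 / (net.L : ℝ)) ^ net.L =
        1 / (net.L : ℝ) * ∏ _i ∈ (Finset.range net.L).erase l, (1 / (net.L : ℝ)) := by
      rw [Finset.mul_prod_erase _ (fun _ => 1 / (net.L : ℝ)) (Finset.mem_range.2 hl),
        Finset.prod_const, Finset.card_range]
    rw [e]
    refine mul_le_mul (by linarith [ha0 l (A l)]) ?_ (Finset.prod_nonneg fun _ _ => hL0.le)
      (by linarith [ha0 l (A l)])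
    exact Finset.prod_le_prod (fun _ _ => hL0.le) fun i _ => by
      linarith [apply_nonneg (normW i) (A i)]
  have h2 : 1 ≤ (a l (A l) + 1 / (net.L : ℝ)) * net.prodExcept normW A l * net.L ^ net.L := by
    have : (1 / (net.L : ℝ)) ^ net.L * (net.L : ℝ) ^ net.L = 1 := by
      rw [← mul_pow]; field_simp; simp
    exact this.symm.le.trans (mul_le_mul_of_nonneg_right h1 (by positivity))
  have h3 : r l * 1 ≤ r l * ((X + 1) *
      ((a l (A l) + 1 / (net.L : ℝ)) * net.prodExcept normW A l * net.L ^ net.L)) :=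
    mul_le_mul_of_nonneg_left (by nlinarith) hr
  rw [capTerm]
  linarith

theorem log_card_upd_le {n : ℕ} (hn : 9 ≤ n) {l : ℕ} {W : ℝ} (hO : 0 < net.O l)
    (hm : 0 < net.m (l + 1)) (hW : (net.O l : ℝ) * net.m (l + 1) ≤ W) :
    Real.log (2 * Fintype.card (net.Upd n l) * (6 * n ^ 2)) ≤ 4 * Real.logb 2 (7 * W * n) := by
  have hn' : (9 : ℝ) ≤ n := by exact_mod_cast hn
  have hO' : (1 : ℝ) ≤ net.O l := by exact_mod_cast hO
  have hm' : (1 : ℝ) ≤ net.m (l + 1) := by exact_mod_cast hm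
  have hOm : (1 : ℝ) ≤ net.O l * net.m (l + 1) := by nlinarith
  have hW1 : 1 ≤ W := hOm.trans hW
  have hcard : (Fintype.card (net.Upd n l) : ℝ) = 4 * n ^ 2 * (net.O l * net.m (l + 1)) := by
    simp only [Fintype.card_prod, Fintype.card_fin, Fintype.card_bool]
    push_cast
    ring
  have h1 : 2 * (Fintype.card (net.Upd n l) : ℝ) * (6 * n ^ 2) ≤ (7 * W * n) ^ 4 := by
    rw [hcard]
    have h2 : (net.O l : ℝ) * net.m (l + 1) * n ^ 4 ≤ W ^ 4 * n ^ 4 := by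
      gcongr
      exact hW.trans (le_self_pow₀ hW1 (by norm_num))
    have h3 : (0 : ℝ) ≤ W ^ 4 * n ^ 4 := by positivity
    nlinarith
  have hpos : 0 < 2 * (Fintype.card (net.Upd n l) : ℝ) * (6 * n ^ 2) := by rw [hcard]; positivity
  have h4 := Real.log_le_log hpos h1
  rw [Real.log_pow] at h4
  have h5 : Real.log (7 * W * n) ≤ Real.logb 2 (7 * W * n) := by
    rw [Real.logb]
    refine le_div_self (Real.log_nonneg (by nlinarith)) (Real.log_pos one_lt_two) ?_
    linarith [Real.log_two_lt_d9]
  push_cast at h4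
  linarith

set_option maxHeartbeats 1000000 in
theorem exists_description {n : ℕ} (hn : 9 ≤ n) (normA : ∀ l, Seminorm ℝ (net.Act l))
    (normW : ∀ l, Seminorm ℝ (net.Wt l)) (hG0 : ∀ l < net.L, net.G l 0 = 0)
    (hpatch : ∀ l < net.L, ∀ x : net.Act l, net.patchNorm l x ≤ normA l x)
    (hout : ∀ x : net.Act net.L, ‖x‖ ≤ normA net.L x)
    (hLip : ∀ l < net.L, ∀ (A : net.Wt l) (x y : net.Act l),
      normA (l + 1) (net.layer l A x - net.layer l A y) ≤ normW l A * normA l (x - y))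
    (M : ∀ l, net.Wt l) (a : ∀ l, net.Wt l → ℝ) (ha0 : ∀ l A, 0 ≤ a l A)
    (had : ∀ l A, a l A ≤ net.dist21 l A (M l)) (r : ℕ → ℝ) (hr : ∀ l < net.L, 0 < r l)
    (happ : ∀ l < net.L, net.LayerApprox n l normA (M l) (a l) (r l))
    (hOm : ∀ l < net.L, 0 < net.O l ∧ 0 < net.m (l + 1))
    {l₀ : ℕ} (hl₀ : l₀ < net.L) (hmax : ∀ l < net.L, r l ≤ r l₀) (hLn : net.L ≤ n)
    {W : ℝ} (hW : ∀ l < net.L, (net.O l : ℝ) * net.m (l + 1) ≤ W)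
    (A : ∀ l, net.Wt l) {X γ T : ℝ} (hX : 0 ≤ X) (hγ : 0 < γ) (hT : 0 < T) (α : ℕ → ℝ)
    (hα : ∀ l < net.L, 0 < α l) (hα1 : ∑ l ∈ Finset.range net.L, α l ≤ 1)
    (hq : ∑ l ∈ Finset.range net.L, (net.capTerm normW a r A X l / α l) ^ 2 ≤ T ^ 2)
    (hTq : T ≤ net.L ^ 2 * ∑ l ∈ Finset.range net.L, net.capTerm normW a r A X l)
    (hsize : γ ≤ 2 * (X * ∏ i ∈ Finset.range net.L, normW i (A i)))
    (hR : 25600 * (T / γ) ^ 2 ≤ n) :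
    ∃ (jx : ℕ) (j : ℤ) (b c : ℝ), X < 2 ^ jx ∧ 0 < 2 ^ j * (128 * r l₀) ∧ 2 ^ j * (128 * r l₀) ≤ γ ∧
      0 ≤ b ∧
      Describable (n := n) (net.codeSet (normA 0) M (128 * r l₀)) net.codeWeight
        (net.lowMargin (normA 0) A (2 ^ jx) (2 ^ j * (128 * r l₀) / 5))
        (net.highMargin (normA 0) A (2 ^ jx) (2 ^ j * (128 * r l₀))) b ∧
      b ≤ 9 / 2 * net.logTerm normW M A X + c ∧
      2 * c ≤ (1536 * (T / γ) * Real.log n) ^ 2 * Real.logb 2 (7 * W * n) := by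
  classical
  have hL := net.one_le_L
  have hLpos := net.L_pos
  have hn' : (9 : ℝ) ≤ n := by exact_mod_cast hn
  have hL0 : 0 < 1 / (net.L : ℝ) := by positivity
  set Λ := Real.logb 2 (7 * W * n) with hΛdef
  set S := net.logTerm normW M A X with hSdef
  set q : ℕ → ℝ := net.capTerm normW a r A X with hqdef
  have hS := net.three_mul_le_logTerm normW M A hX
  have hW1 : 1 ≤ W := by
    obtain ⟨h1, h2⟩ := hOm l₀ hl₀
    have h1' : (1 : ℝ) ≤ net.O l₀ := by exact_mod_cast h1
    have h2' : (1 : ℝ) ≤ net.m (l₀ + 1) := by exact_mod_cast h2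
    exact le_trans (by nlinarith) (hW l₀ hl₀)
  have hΛ : Real.logb 2 (7 * n) ≤ Λ := by
    refine Real.logb_le_logb_of_le one_lt_two (by positivity) ?_
    nlinarith
  have hΛ0 : 0 ≤ Λ := (Real.logb_nonneg one_lt_two (by linarith)).trans hΛ
  have hr₀ := hr l₀ hl₀
  have hα_le : ∀ l < net.L, α l ≤ 1 := fun l hl =>
    (Finset.single_le_sum (fun i hi => (hα i (Finset.mem_range.1 hi)).le)
      (Finset.mem_range.2 hl)).trans hα1
  have hq0 : ∀ l < net.L, 0 < q l := fun l hl => by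
    have := ha0 l (A l)
    have := hr l hl
    have := net.prodExcept_pos normW A l
    simp only [hqdef, capTerm]
    positivity
  have hqT : ∀ l < net.L, q l / α l ≤ T := fun l hl => by
    refine le_of_sq_le_sq ?_ hT.le
    exact (Finset.single_le_sum (f := fun l => (q l / α l) ^ 2) (fun i _ => sq_nonneg _)
      (Finset.mem_range.2 hl)).trans hq
  have hlow : r l₀ ≤ T * net.L ^ net.L := by
    refine (net.le_capTerm normW a ha0 r A hX hl₀ hr₀.le).trans
      (mul_le_mul_of_nonneg_right (le_trans ?_ (hqT l₀ hl₀)) (by positivity))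
    exact le_div_self (hq0 l₀ hl₀).le (hα l₀ hl₀) (hα_le l₀ hl₀)
  have hup : T ≤ net.L ^ (3 + net.L) * Real.exp S * r l₀ := by
    have h1 : ∑ l ∈ Finset.range net.L, q l ≤
        net.L * (r l₀ * (net.L ^ net.L * Real.exp S)) := by
      rw [← nsmul_eq_mul, ← Finset.card_range net.L, ← Finset.sum_const, Finset.card_range]
      refine Finset.sum_le_sum fun l hl => ?_
      have hl := Finset.mem_range.1 hl
      exact (net.capTerm_le normW M a ha0 had r A hX hl (hr l hl).le).trans
        (mul_le_mul_of_nonneg_right (hmax l hl) (by positivity))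
    refine hTq.trans ((mul_le_mul_of_nonneg_left h1 (by positivity)).trans (le_of_eq ?_))
    rw [pow_add]
    ring
  obtain ⟨jx, hjx1, hjx2, hjx3⟩ := exists_radius hX
  obtain ⟨j, c₀, κ, hjγ, hjn, hc₀, hκ0, hcost, hκ, hbudget⟩ :=
    exists_margin_scale hn hLpos hΛ hγ hT hr₀ hlow hup hR hS
  set γ' : ℝ := 2 ^ j * (128 * r l₀) with hγ'
  have hγ'0 : 0 < γ' := by positivity
  set x₀ : ℝ := 2 ^ jx with hx₀
  have hx₀p : 0 < x₀ := by positivity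
  set β : ℕ → ℝ := fun i => normW i (A i) + 1 / (net.L : ℝ) with hβ
  have hβ0 : ∀ i, 0 < β i := fun i => add_pos_of_nonneg_of_pos (apply_nonneg _ _) hL0
  have hβle : ∀ i, normW i (A i) ≤ β i := fun i => by simp only [hβ]; linarith
  set pre : ℕ → ℝ := fun l => ∏ i ∈ Finset.range l, β i with hpre
  set suf : ℕ → ℝ := fun l => ∏ i ∈ Finset.Ico (l + 1) net.L, β i with hsuf
  have hpre0 : ∀ l, 0 < pre l := fun l => Finset.prod_pos fun i _ => hβ0 i
  have hsuf0 : ∀ l, 0 < suf l := fun l => Finset.prod_pos fun i _ => hβ0 i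
  have hεx : γ' / 5 ≤ x₀ * ∏ i ∈ Finset.range net.L, β i := by
    have h1 : X * ∏ i ∈ Finset.range net.L, normW i (A i) ≤ x₀ * ∏ i ∈ Finset.range net.L, β i :=
      mul_le_mul hjx1.le (Finset.prod_le_prod (fun i _ => apply_nonneg _ _) fun i _ => hβle i)
        (Finset.prod_nonneg fun i _ => apply_nonneg _ _) hx₀p.le
    linarith
  -- the scales of the layers
  have hex : ∀ l, ∃ e : ℤ, l < net.L →
      (2 : ℝ) ^ e ≤ α l * (γ' / 5) / (r l * (2 * x₀ * pre l) * suf l) ∧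
      α l * (γ' / 5) / (r l * (2 * x₀ * pre l) * suf l) < 2 ^ (e + 1) := fun l => by
    by_cases hl : l < net.L
    · have := hr l hl
      have := hα l hl
      have := hpre0 l
      have := hsuf0 l
      obtain ⟨e, he⟩ := exists_mem_Ico_zpow (x := α l * (γ' / 5) / (r l * (2 * x₀ * pre l) * suf l))
        (y := (2 : ℝ)) (by positivity) one_lt_two
      exact ⟨e, fun _ => he⟩
    · exact ⟨0, fun h => absurd h hl⟩
  choose e he1 using hex
  set K : ℕ → ℝ := fun l => 6400 * (q l / α l / γ') ^ 2 with hK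
  have hKsum : ∑ l ∈ Finset.range net.L, K l ≤ 6400 * (T / γ') ^ 2 := by
    have e1 : ∑ l ∈ Finset.range net.L, K l =
        6400 / γ' ^ 2 * ∑ l ∈ Finset.range net.L, (q l / α l) ^ 2 := by
      rw [Finset.mul_sum]
      exact Finset.sum_congr rfl fun l _ => by rw [hK]; field_simp
    rw [e1]
    refine (mul_le_mul_of_nonneg_left hq (by positivity)).trans (le_of_eq ?_)
    field_simp
  have hK0 : ∀ l, 0 ≤ K l := fun l => by rw [hK]; positivity
  have hKle : ∀ l < net.L, K l ≤ 6400 * (T / γ') ^ 2 := fun l hl =>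
    (Finset.single_le_sum (fun i _ => hK0 i) (Finset.mem_range.2 hl)).trans hKsum
  have hstep : ∀ l < net.L, (2 * (a l (A l) + 1 / (net.L : ℝ))) ^ 2 ≤ K l * ((2 : ℝ) ^ e l) ^ 2 := by
    intro l hl
    have hrl := hr l hl
    have hαl := hα l hl
    have hp := hpre0 l
    have hs := hsuf0 l
    have ha : 0 < a l (A l) + 1 / (net.L : ℝ) := by have := ha0 l (A l); positivity
    have h1 := (he1 l hl).2
    rw [zpow_add_one₀ (by norm_num), div_lt_iff₀ (by positivity)] at h1
    have hql : q l = (X + 1) * ((a l (A l) + 1 / (net.L : ℝ)) * r l * (pre l * suf l)) := by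
      rw [hqdef, capTerm, net.prodExcept_eq normW A hl]
    have h2 : 2 * (a l (A l) + 1 / (net.L : ℝ)) ≤ 80 * (q l / α l / γ') * 2 ^ e l := by
      rw [div_div, ← mul_div_assoc, div_mul_eq_mul_div, le_div_iff₀ (by positivity), hql]
      set s : ℝ := a l (A l) + 1 / (net.L : ℝ) with hs'
      have h3 : s * (α l * γ') ≤ s * (20 * ((2 : ℝ) ^ e l * (r l * x₀ * (pre l * suf l)))) :=
        mul_le_mul_of_nonneg_left (by linarith) ha.le
      have h4 : s * (20 * ((2 : ℝ) ^ e l * (r l * x₀ * (pre l * suf l)))) ≤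
          s * (20 * ((2 : ℝ) ^ e l * (r l * (2 * (X + 1)) * (pre l * suf l)))) := by gcongr
      linarith
    have h5 := pow_le_pow_left₀ (by positivity) h2 2
    refine h5.trans (le_of_eq ?_)
    rw [hK]; ring
  have hen : ∀ l < net.L, (2 * a l (A l)) ^ 2 ≤ (2 * (a l (A l) + 1 / (net.L : ℝ))) ^ 2 :=
    fun l _ => pow_le_pow_left₀ (by have := ha0 l (A l); positivity) (by linarith) 2
  have hstepn : ∀ l < net.L, (2 * (a l (A l) + 1 / (net.L : ℝ))) ^ 2 ≤ n * ((2 : ℝ) ^ e l) ^ 2 :=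
    fun l hl => (hstep l hl).trans
      (mul_le_mul_of_nonneg_right ((hKle l hl).trans hjn) (by positivity))
  have hdL : ∀ l, 0 ≤ net.dist21 l (A l) (M l) / net.L := fun l =>
    div_nonneg (net.dist21_nonneg _ _ _) (by positivity)
  have hbL : ∀ l, 0 ≤ normW l (A l) / net.L := fun l => div_nonneg (apply_nonneg _ _) (by positivity)
  set cl : ℕ → ℝ := fun l => Real.log 2 + Real.log (2 + net.dist21 l (A l) (M l) / net.L) +
    ⌊K l⌋₊ * (4 * Λ) with hcl
  have hlog2 : 0 < Real.log 2 := Real.log_pos one_lt_two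
  have hcl0 : ∀ l, 0 ≤ cl l := fun l => by
    have := Real.log_nonneg (by linarith [hdL l] : (1 : ℝ) ≤ 2 + net.dist21 l (A l) (M l) / net.L)
    simp only [hcl]; positivity
  have hjx4 : 0 ≤ Real.log (((jx : ℝ) + 1) * (jx + 2)) := by
    have : (0 : ℝ) ≤ jx := by positivity
    exact Real.log_nonneg (by nlinarith)
  have hj4 : 0 ≤ Real.log (2 * (((j.natAbs : ℝ) + 1) * (j.natAbs + 2))) := by
    have : (0 : ℝ) ≤ j.natAbs := by positivity
    exact Real.log_nonneg (by nlinarith)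
  refine ⟨jx, j, Real.log (((jx : ℝ) + 1) * (jx + 2)) +
    Real.log (2 * (((j.natAbs : ℝ) + 1) * (j.natAbs + 2))) + ∑ l ∈ Finset.range net.L, cl l,
    4 * Λ * κ + c₀, hjx1, hγ'0, hjγ, ?_, ?_, ?_, hbudget⟩
  · exact add_nonneg (add_nonneg hjx4 hj4) (Finset.sum_nonneg fun l _ => hcl0 l)
  · intro z
    obtain ⟨c, hc1, hc2⟩ := net.exists_code normA normW hG0 hpatch hLip M a r
      (fun l hl => (hr l hl).le) happ A β α hβle hβ0 (fun l hl => (hα l hl).le) hα1 hx₀p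
      (by positivity : 0 < γ' / 5) hεx e (fun l hl => by
        have h1 := (he1 l hl).1
        have := hr l hl
        have := hpre0 l
        have := hsuf0 l
        rw [le_div_iff₀ (by positivity)] at h1
        calc r l * 2 ^ e l * (2 * x₀ * pre l) * suf l
            = 2 ^ e l * (r l * (2 * x₀ * pre l) * suf l) := by ring
          _ ≤ _ := h1) (fun l hl => (hen l hl).trans (hstepn l hl))
      (fun p => (samplePt z p).1)
    refine ⟨(jx, j, fun l : Fin net.L => c l), ?_, ?_⟩
    · have hcongr : net.codeAct M (fun p => (samplePt z p).1)
          (net.extendCode fun l : Fin net.L => c l) net.L =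
          net.codeAct M (fun p => (samplePt z p).1) c net.L :=
        net.codeAct_congr M _ _ _ (fun l hl => by simp [extendCode, hl]) net.L le_rfl
      refine net.separates_codeSet normA hout M A (128 * r l₀) z
        (jx, j, fun l : Fin net.L => c l) fun p hp => ?_
      dsimp only at hp ⊢
      rw [hcongr]
      exact hc2 p hp
    · rw [neg_add, neg_add, Real.exp_add, Real.exp_add, mul_assoc, codeWeight]
      have e1 : Real.exp (-Real.log (((jx : ℝ) + 1) * (jx + 2))) = natWeight jx := by
        rw [← Real.log_inv, Real.exp_log (by positivity), natWeight, one_div]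
      have e2 : Real.exp (-Real.log (2 * (((j.natAbs : ℝ) + 1) * (j.natAbs + 2)))) = intWeight j := by
        rw [← Real.log_inv, Real.exp_log (by positivity), intWeight, natWeight, mul_inv]
        simp
      rw [e1, e2]
      refine mul_le_mul_of_nonneg_left (mul_le_mul_of_nonneg_left ?_ (subProb_intWeight.1 _))
        (subProb_natWeight.1 _)
      rw [← Finset.sum_neg_distrib, Finset.sum_range, Real.exp_sum]
      refine Finset.prod_le_prod (fun _ _ => (Real.exp_pos _).le) fun l _ => ?_
      obtain ⟨l, hl⟩ := l
      dsimp only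
      obtain ⟨hlen, hnil, hcons⟩ := hc1 l hl
      obtain ⟨hO, hm⟩ := hOm l hl
      have hne : Nonempty (net.Upd n l) :=
        ⟨((⟨0, by omega⟩, true), ⟨0, hO⟩), ⟨0, hm⟩, true, ⟨0, by omega⟩⟩
      have he0 : (0 : ℝ) < (2 ^ e l) ^ 2 := by positivity
      refine exp_neg_le_layerWeight (c l) (Q := 6 * n ^ 2) _ ?_ hnil (by nlinarith)
        (by linarith [hdL l]) (fun h => ?_) (net.log_card_upd_le hn hO hm (hW l hl))
      · refine Nat.le_floor (le_of_mul_le_mul_right ?_ he0)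
        exact hlen.trans ((hen l hl).trans (hstep l hl))
      · have hlen1 : (1 : ℝ) ≤ (c l).1.length := by
          exact_mod_cast List.length_pos_iff.2 h
        have h1 : ((2 : ℝ) ^ e l) ^ 2 ≤ (2 * a l (A l)) ^ 2 :=
          le_trans (le_mul_of_one_le_left he0.le hlen1) hlen
        have h2 := two_pow_natAbs_le hLpos hLn (by omega) (ha0 l (A l)) (had l (A l)) h1
          (hstepn l hl)
        have h3 := one_div_le_intWeight (e l) h2
        rw [hcons h, mul_assoc]
        exact h3
  · have hfloor : ∑ l ∈ Finset.range net.L, (⌊K l⌋₊ : ℝ) ≤ κ := by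
      rcases hκ with h | h
      · have : ∀ l ∈ Finset.range net.L, (⌊K l⌋₊ : ℝ) = 0 := fun l hl => by
          rw [Nat.floor_eq_zero.2 ((hKle l (Finset.mem_range.1 hl)).trans_lt h), Nat.cast_zero]
        rw [Finset.sum_congr rfl this]
        simpa using hκ0
      · exact (Finset.sum_le_sum fun l _ => Nat.floor_le (hK0 l)).trans (hKsum.trans h)
    have hx : Real.log (((jx : ℝ) + 1) * (jx + 2)) ≤ 2 * Real.log (2 + X) := by
      have := Real.log_le_log (by positivity) hjx3
      rwa [Real.log_pow, Nat.cast_two] at this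
    have hlX : 0 ≤ Real.log (2 + X) := Real.log_nonneg (by linarith)
    have hla : ∀ l, 0 ≤ Real.log (2 + net.dist21 l (A l) (M l) / net.L) := fun l =>
      Real.log_nonneg (by linarith [hdL l])
    have hlb : ∀ l, Real.log 2 ≤ Real.log (2 + normW l (A l) / net.L) := fun l =>
      Real.log_le_log (by norm_num) (by linarith [hbL l])
    have hxL : 2 * Real.log (2 + X) ≤ ∑ _l ∈ Finset.range net.L, 2 * Real.log (2 + X) := by
      rw [Finset.sum_const, Finset.card_range, nsmul_eq_mul]
      nlinarith
    have h1 : ∑ l ∈ Finset.range net.L, 2 * Real.log (2 + X) + ∑ l ∈ Finset.range net.L, cl l ≤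
        2 * S + 4 * Λ * κ := by
      have h2 : ∑ l ∈ Finset.range net.L, cl l =
          ∑ l ∈ Finset.range net.L, (Real.log 2 +
            Real.log (2 + net.dist21 l (A l) (M l) / net.L)) +
          4 * Λ * ∑ l ∈ Finset.range net.L, (⌊K l⌋₊ : ℝ) := by
        rw [Finset.mul_sum, ← Finset.sum_add_distrib]
        exact Finset.sum_congr rfl fun l _ => by simp only [hcl]; ring
      have h3 : 4 * Λ * ∑ l ∈ Finset.range net.L, (⌊K l⌋₊ : ℝ) ≤ 4 * Λ * κ :=
        mul_le_mul_of_nonneg_left hfloor (by positivity)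
      have h4 : ∑ l ∈ Finset.range net.L, 2 * Real.log (2 + X) +
          ∑ l ∈ Finset.range net.L, (Real.log 2 +
            Real.log (2 + net.dist21 l (A l) (M l) / net.L)) ≤ 2 * S := by
        rw [hSdef, logTerm, Finset.mul_sum, ← Finset.sum_add_distrib]
        refine Finset.sum_le_sum fun l _ => ?_
        linarith [hla l, hlb l]
      rw [h2]
      linarith
    linarith

end ConvNet

namespace ConvNet

variable (net : ConvNet)

/-! ### The generalisation bound for an abstract capacity -/

theorem normA_F_eq_zero (normA : ∀ l, Seminorm ℝ (net.Act l)) (normW : ∀ l, Seminorm ℝ (net.Wt l))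
    (hG0 : ∀ l < net.L, net.G l 0 = 0)
    (hLip : ∀ l < net.L, ∀ (A : net.Wt l) (x y : net.Act l),
      normA (l + 1) (net.layer l A x - net.layer l A y) ≤ normW l A * normA l (x - y))
    (A : ∀ l, net.Wt l) (x : net.Act 0) {m : ℕ} (hm : normA m (net.F A m x) = 0) (l : ℕ)
    (hml : m ≤ l) (hl : l ≤ net.L) : normA l (net.F A l x) = 0 := by
  induction l, hml using Nat.le_induction with
  | base => exact hm
  | succ l _ ih =>
    have h := hLip l hl (A l) (net.F A l x) 0
    rw [net.layer_zero l (hG0 l hl), sub_zero, sub_zero, ih (Nat.le_of_succ_le hl), mul_zero] at h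
    exact le_antisymm h (apply_nonneg _ _)

theorem lt_score_sub_of_lt_margin (A : ∀ l, net.Wt l) (x : net.Act 0) (y : Fin net.K) {γ : ℝ}
    (h : γ < net.margin A x y) (c : Fin net.K) (hc : c ≠ y) :
    γ < net.score A x y - net.score A x c := by
  have h1 : net.score A x c ≤ ⨆ c : {c : Fin net.K // c ≠ y}, net.score A x c :=
    le_ciSup (f := fun c : {c : Fin net.K // c ≠ y} => net.score A x c)
      (Set.finite_range _).bddAbove ⟨c, hc⟩
  rw [margin] at h
  linarith

theorem lt_two_mul_norm_of_lt_margin (hK : 2 ≤ net.K) (A : ∀ l, net.Wt l) (x : net.Act 0)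
    (y : Fin net.K) {γ : ℝ} (h : γ < net.margin A x y) : γ < 2 * ‖net.F A net.L x‖ := by
  have : Nontrivial (Fin net.K) := Fin.nontrivial_iff_two_le.2 hK
  obtain ⟨c, hc⟩ := exists_ne y
  have h1 := net.lt_score_sub_of_lt_margin A x y h c hc
  have h2 : ∀ c, |net.score A x c| ≤ ‖net.F A net.L x‖ := fun c =>
    (norm_le_pi_norm (net.F A net.L x c) _).trans (norm_le_pi_norm (net.F A net.L x) c)
  have h3 := (abs_le.1 (h2 y)).2
  have h4 := (abs_le.1 (h2 c)).1
  linarith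

theorem gam_nonneg (normA : ∀ l, Seminorm ℝ (net.Act l)) (normW : ∀ l, Seminorm ℝ (net.Wt l))
    (M : ∀ l, net.Wt l) {n : ℕ} (s : Fin n → net.Act 0 × Fin net.K) (A : ∀ l, net.Wt l) :
    0 ≤ net.gam normA normW M s A := by
  refine mul_nonneg ?_ (Real.iSup_nonneg fun l => ?_)
  · have : 0 ≤ net.sampleNorm normA s := Real.iSup_nonneg fun _ => apply_nonneg _ _
    linarith
  · have h1 := net.dist21_nonneg l (A l) (M l)
    have h2 := net.prodExcept_pos normW A l
    positivity

/-- A lower bound of the risk bound, over the common denominator `√n`. -/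
theorem le_riskBound (normA : ∀ l, Seminorm ℝ (net.Act l)) (normW : ∀ l, Seminorm ℝ (net.Wt l))
    (M : ∀ l, net.Wt l) {n : ℕ} (hn : 0 < n) (s : Fin n → net.Act 0 × Fin net.K)
    (A : ∀ l, net.Wt l) (γ : ℝ) {δ R Λ : ℝ} (hR : 0 ≤ R)
    (hΛ : Λ ≤ Real.logb 2 (32 * net.gam normA normW M s A * (n : ℝ) ^ 2 + 7 * net.preWidth * n)) :
    ((n : ℝ) - (Nat.card {i : Fin n // γ < net.margin A (s i).1 (s i).2} : ℝ)) / n + 8 / n +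
      (1536 * R * Real.log n * Real.sqrt Λ + 3 * Real.sqrt (Real.log (2 / δ) / 2) +
        3 * Real.sqrt (net.logTerm normW M A (net.sampleNorm normA s))) / Real.sqrt n ≤
      net.riskBound normA normW M s A γ δ R := by
  have hn' : (0 : ℝ) < n := Nat.cast_pos.2 hn
  have hsn : 0 < Real.sqrt n := Real.sqrt_pos.2 hn'
  have hlog : 0 ≤ Real.log n := Real.log_natCast_nonneg n
  have e1 : Real.sqrt (Real.log (2 / δ) / (2 * n)) = Real.sqrt (Real.log (2 / δ) / 2) / Real.sqrt n := by
    rw [← div_div, Real.sqrt_div' _ hn'.le]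
  have e2 : Real.sqrt (1 / n * net.logTerm normW M A (net.sampleNorm normA s)) =
      Real.sqrt (net.logTerm normW M A (net.sampleNorm normA s)) / Real.sqrt n := by
    rw [one_div_mul_eq_div, Real.sqrt_div' _ hn'.le]
  have h5 := Real.sqrt_nonneg (Real.log (2 / (γ * n)))
  have h3 : 1536 * R * Real.log n * Real.sqrt Λ / Real.sqrt n ≤ 1536 / Real.sqrt n * R *
      Real.sqrt (Real.logb 2
        (32 * net.gam normA normW M s A * (n : ℝ) ^ 2 + 7 * net.preWidth * n)) * Real.log n := by
    have : 1536 * R * Real.log n * Real.sqrt Λ / Real.sqrt n =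
        1536 / Real.sqrt n * R * Real.sqrt Λ * Real.log n := by ring
    rw [this]
    gcongr
  rw [riskBound, e1]
  change _ ≤ _ + _ + _ + _ + _ + 3 * Real.sqrt (1 / n * net.logTerm normW M A (net.sampleNorm normA s))
  rw [e2, add_div, add_div, mul_div_assoc 3, mul_div_assoc 3]
  linarith

theorem sqrt_cost_le {b S c V Λ ℓ : ℝ} (hb : b ≤ 9 / 2 * S + c) (hc : 2 * c ≤ V ^ 2 * Λ) (hV : 0 ≤ V)
    (hΛ : 0 ≤ Λ) (hS : 0 ≤ S) (hℓ : 1 / 2 ≤ ℓ) :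
    Real.sqrt (2 * (b + ℓ)) + 1 / 2 ≤
      V * Real.sqrt Λ + 3 * Real.sqrt (ℓ / 2) + 3 * Real.sqrt S := by
  have h1 : 1 / 2 ≤ Real.sqrt (ℓ / 2) := by
    refine Real.le_sqrt_of_sq_le ?_; linarith
  have h2 : Real.sqrt (2 * (b + ℓ)) ≤ V * Real.sqrt Λ + 2 * Real.sqrt (ℓ / 2) + 3 * Real.sqrt S := by
    refine Real.sqrt_le_iff.2 ⟨by positivity, ?_⟩
    have e1 := Real.sq_sqrt hΛ
    have e2 := Real.sq_sqrt hS
    have e3 := Real.sq_sqrt (by linarith : 0 ≤ ℓ / 2)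
    have p1 : 0 ≤ V * Real.sqrt Λ * Real.sqrt (ℓ / 2) := by positivity
    have p2 : 0 ≤ V * Real.sqrt Λ * Real.sqrt S := by positivity
    have p3 : 0 ≤ Real.sqrt (ℓ / 2) * Real.sqrt S := by positivity
    have e4 : (V * Real.sqrt Λ + 2 * Real.sqrt (ℓ / 2) + 3 * Real.sqrt S) ^ 2 =
        V ^ 2 * Real.sqrt Λ ^ 2 + 4 * Real.sqrt (ℓ / 2) ^ 2 + 9 * Real.sqrt S ^ 2 +
        4 * (V * Real.sqrt Λ * Real.sqrt (ℓ / 2)) + 6 * (V * Real.sqrt Λ * Real.sqrt S) +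
        12 * (Real.sqrt (ℓ / 2) * Real.sqrt S) := by ring
    rw [e4, e1, e2, e3]
    linarith
  linarith

set_option maxHeartbeats 1000000 in
theorem generalisation_of_capacity (hK : 2 ≤ net.K) (n : ℕ) (hn : 0 < n) (ρ : ℕ → ℝ≥0)
    (hG : ∀ l < net.L, LipschitzWith (ρ (l + 1)) (net.G l))
    (hG0 : ∀ l < net.L, net.G l 0 = 0)
    (normA : ∀ l, Seminorm ℝ (net.Act l))
    (normW : ∀ l, Seminorm ℝ (net.Wt l))
    (hpatch : ∀ l < net.L, ∀ x : net.Act l, net.patchNorm l x ≤ normA l x)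
    (hout : ∀ x : net.Act net.L, ‖x‖ ≤ normA net.L x)
    (hLip : ∀ l < net.L, ∀ (A : net.Wt l) (x y : net.Act l),
      normA (l + 1) (net.layer l A x - net.layer l A y) ≤ normW l A * normA l (x - y))
    (μ : Measure (net.Act 0 × Fin net.K)) [IsProbabilityMeasure μ]
    (M : ∀ l, net.Wt l) (δ : ℝ) (hδ : 0 < δ)
    (a : ∀ l, net.Wt l → ℝ) (ha0 : ∀ l A, 0 ≤ a l A)
    (had : ∀ l A, a l A ≤ net.dist21 l A (M l)) (r : ℕ → ℝ) (hr0 : ∀ l, 0 ≤ r l)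
    (hrz : ∀ l < net.L, r l = 0 → ∀ A x, normA (l + 1) (net.layer l A x) = 0)
    (happ : ∀ l < net.L, net.LayerApprox n l normA (M l) (a l) (r l))
    (T : (∀ l, net.Wt l) → ℝ → ℝ) (hT0 : ∀ A X, 0 ≤ X → 0 ≤ T A X)
    (hT : ∀ A X, 0 ≤ X → (∀ l < net.L, 0 < r l) → 0 < T A X ∧
      T A X ≤ net.L ^ 2 * ∑ l ∈ Finset.range net.L, net.capTerm normW a r A X l ∧
      ∃ α : ℕ → ℝ, (∀ l < net.L, 0 < α l) ∧ ∑ l ∈ Finset.range net.L, α l ≤ 1 ∧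
        ∑ l ∈ Finset.range net.L, (net.capTerm normW a r A X l / α l) ^ 2 ≤ T A X ^ 2) :
    (Measure.pi fun _ : Fin n => μ)
      {s | ∀ (A : ∀ l, net.Wt l) (γ : ℝ), 0 < γ →
        μ.real (net.errorSet A) ≤
          net.riskBound normA normW M s A γ δ (T A (net.sampleNorm normA s) / γ)}ᶜ ≤
      ENNReal.ofReal δ := by
  classical
  rcases le_or_gt 1 δ with hδ1 | hδ1
  · refine prob_le_one.trans ?_
    rw [← ENNReal.ofReal_one]
    exact ENNReal.ofReal_le_ofReal hδ1
  have hn' : (0 : ℝ) < n := Nat.cast_pos.2 hn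
  obtain ⟨l₀, hl₀, hmax⟩ := Finset.exists_max_image (Finset.range net.L) r
    ⟨0, Finset.mem_range.2 net.L_pos⟩
  have hl₀ := Finset.mem_range.1 hl₀
  have hmax : ∀ l < net.L, r l ≤ r l₀ := fun l hl => hmax l (Finset.mem_range.2 hl)
  have : Nonempty (net.Code n) := ⟨(0, 0, fun _ => ([], 0))⟩
  refine (measure_mono ?_).trans (measure_exists_describable_le μ hn
    (net.codeSet (normA 0) M (128 * r l₀)) net.codeWeight (net.subProb_codeWeight n) hδ
    (by linarith))
  intro s hs
  simp only [Set.mem_compl_iff, Set.mem_ofPred_eq, not_forall, not_le] at hs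
  obtain ⟨A, γ, hγ, hbad⟩ := hs
  set X := net.sampleNorm normA s with hXdef
  have hX : 0 ≤ X := Real.iSup_nonneg fun _ => apply_nonneg _ _
  have hxX : ∀ i, normA 0 (s i).1 ≤ X := fun i =>
    le_ciSup (f := fun i => normA 0 (s i).1) (Set.finite_range _).bddAbove i
  set R := T A X / γ with hRdef
  have hR0 : 0 ≤ R := div_nonneg (hT0 A X hX) hγ.le
  set S := net.logTerm normW M A X with hSdef
  have hS3 := net.three_mul_le_logTerm normW M A hX
  have hL := net.one_le_L
  have hl2 := Real.log_two_gt_d9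
  have hS0 : 0 ≤ S := le_trans (by positivity) hS3
  set cnt : ℝ := (Nat.card {i : Fin n // γ < net.margin A (s i).1 (s i).2} : ℝ) with hcnt
  have hcntn : cnt ≤ n := by
    have h := Finite.card_subtype_le fun i : Fin n => γ < net.margin A (s i).1 (s i).2
    rw [Nat.card_fin] at h
    exact Nat.cast_le.2 h
  have hp1 : μ.real (net.errorSet A) ≤ 1 := measureReal_le_one
  have hlogn : 0 ≤ Real.log n := Real.log_natCast_nonneg n
  have hsn : 0 < Real.sqrt n := Real.sqrt_pos.2 hn'
  set ℓ := Real.log (2 / δ) with hℓ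
  have hℓ2 : 1 / 2 ≤ ℓ := by
    have : Real.log 2 ≤ ℓ := Real.log_le_log (by norm_num) (by rw [le_div_iff₀ hδ]; linarith)
    linarith
  have hbound : ∀ Λ : ℝ,
      Λ ≤ Real.logb 2 (32 * net.gam normA normW M s A * (n : ℝ) ^ 2 + 7 * net.preWidth * n) →
      (n - cnt) / n + 8 / n + (1536 * R * Real.log n * Real.sqrt Λ + 3 * Real.sqrt (ℓ / 2) +
        3 * Real.sqrt S) / Real.sqrt n < μ.real (net.errorSet A) := fun Λ hΛ =>
    (net.le_riskBound normA normW M hn s A γ hR0 hΛ).trans_lt hbad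
  -- some sample point has a large margin
  have hpt : ∃ i, γ < net.margin A (s i).1 (s i).2 := by
    by_contra hcon
    push Not at hcon
    have hc0 : cnt = 0 := by
      rw [hcnt, Nat.cast_eq_zero, Nat.card_eq_zero]
      exact Or.inl ⟨fun i => absurd i.2 (not_lt.2 (hcon i.1))⟩
    have := hbound _ le_rfl
    rw [hc0, sub_zero, div_self hn'.ne'] at this
    have h2 : 0 ≤ (1536 * R * Real.log n * Real.sqrt (Real.logb 2
        (32 * net.gam normA normW M s A * (n : ℝ) ^ 2 + 7 * net.preWidth * n)) +
        3 * Real.sqrt (ℓ / 2) + 3 * Real.sqrt S) / Real.sqrt n := by positivity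
    have h3 : 0 ≤ 8 / (n : ℝ) := by positivity
    linarith
  obtain ⟨i₀, hi₀⟩ := hpt
  have hout₀ : γ < 2 * normA net.L (net.F A net.L (s i₀).1) :=
    (net.lt_two_mul_norm_of_lt_margin hK A _ _ hi₀).trans_le
      (mul_le_mul_of_nonneg_left (hout _) two_pos.le)
  have hnz : ∀ l < net.L, normA (l + 1) (net.F A (l + 1) (s i₀).1) ≠ 0 := fun l hl h => by
    rw [net.normA_F_eq_zero normA normW hG0 hLip A _ h net.L hl le_rfl] at hout₀
    linarith
  have hr : ∀ l < net.L, 0 < r l := fun l hl =>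
    (hr0 l).lt_of_ne fun h => hnz l hl (hrz l hl h.symm _ _)
  have hOm : ∀ l < net.L, 0 < net.O l ∧ 0 < net.m (l + 1) := fun l hl => by
    by_contra hcon
    refine hnz l hl ?_
    have hz : net.conv l (A l) (net.F A l (s i₀).1) = 0 := by
      ext jj o
      exact absurd ⟨Fin.pos o, Fin.pos jj⟩ hcon
    change normA (l + 1) (net.layer l (A l) (net.F A l (s i₀).1)) = 0
    rw [layer, hz, hG0 l hl, map_zero]
  have hsize : γ ≤ 2 * (X * ∏ i ∈ Finset.range net.L, normW i (A i)) := by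
    have h1 := net.normA_F_le normA normW hG0 hLip A (s i₀).1 net.L le_rfl
    have h2 : normA 0 (s i₀).1 * ∏ i ∈ Finset.range net.L, normW i (A i) ≤
        X * ∏ i ∈ Finset.range net.L, normW i (A i) :=
      mul_le_mul_of_nonneg_right (hxX i₀) (Finset.prod_nonneg fun i _ => apply_nonneg _ _)
    linarith
  have hW : ∀ l < net.L, (net.O l : ℝ) * net.m (l + 1) ≤ net.preWidth := fun l hl =>
    le_ciSup (f := fun l : Fin net.L => (net.O l : ℝ) * net.m ((l : ℕ) + 1))
      (Set.finite_range _).bddAbove ⟨l, hl⟩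
  have hW1 : 1 ≤ net.preWidth := by
    obtain ⟨h1, h2⟩ := hOm l₀ hl₀
    have h1' : (1 : ℝ) ≤ net.O l₀ := by exact_mod_cast h1
    have h2' : (1 : ℝ) ≤ net.m (l₀ + 1) := by exact_mod_cast h2
    exact le_trans (by nlinarith) (hW l₀ hl₀)
  set Λ := Real.logb 2 (7 * net.preWidth * n) with hΛdef
  have hn1 : (1 : ℝ) ≤ n := by exact_mod_cast hn
  have hΛ1 : 1 ≤ Λ := by
    rw [hΛdef, Real.le_logb_iff_rpow_le one_lt_two (by positivity), Real.rpow_one]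
    nlinarith
  have hmain := hbound Λ (by
    refine Real.logb_le_logb_of_le one_lt_two (by positivity) ?_
    have : 0 ≤ 32 * net.gam normA normW M s A * (n : ℝ) ^ 2 := by
      have := net.gam_nonneg normA normW M s A; positivity
    linarith)
  set V := 1536 * R * Real.log n with hV
  have hV0 : 0 ≤ V := by positivity
  set B := V * Real.sqrt Λ + 3 * Real.sqrt (ℓ / 2) + 3 * Real.sqrt S with hB
  have hB0 : 0 ≤ B := by positivity
  have hmain' : n - cnt + 8 + Real.sqrt n * B < n * μ.real (net.errorSet A) := by
    have h1 := mul_lt_mul_of_pos_left hmain hn'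
    have h2 : (n : ℝ) * ((n - cnt) / n + 8 / n + B / Real.sqrt n) =
        n - cnt + 8 + n / Real.sqrt n * B := by field_simp
    rwa [h2, Real.div_sqrt] at h1
  have hle_n : n * μ.real (net.errorSet A) ≤ n := by nlinarith
  have hn9 : 9 ≤ n := by
    have h1 : 0 ≤ Real.sqrt n * B := by positivity
    have h2 : (8 : ℝ) < n := by linarith
    exact_mod_cast h2
  have hBn : B < Real.sqrt n := by
    have h1 : Real.sqrt n * B < Real.sqrt n * Real.sqrt n := by
      rw [Real.mul_self_sqrt hn'.le]; linarith
    exact lt_of_mul_lt_mul_left h1 hsn.le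
  have hSn : 9 * S ≤ n := by
    have h1 : 3 * Real.sqrt S ≤ Real.sqrt n := by
      have : 0 ≤ V * Real.sqrt Λ + 3 * Real.sqrt (ℓ / 2) := by positivity
      linarith
    have h2 := pow_le_pow_left₀ (by positivity) h1 2
    rw [mul_pow, Real.sq_sqrt hS0, Real.sq_sqrt hn'.le] at h2
    linarith
  have hLn : net.L ≤ n := by
    have : (net.L : ℝ) ≤ n := by nlinarith
    exact_mod_cast this
  have hRn : 25600 * R ^ 2 ≤ n := by
    have h1 : V ≤ Real.sqrt n := by
      have h2 : V * 1 ≤ V * Real.sqrt Λ :=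
        mul_le_mul_of_nonneg_left (Real.one_le_sqrt.2 hΛ1) hV0
      have : 0 ≤ 3 * Real.sqrt (ℓ / 2) + 3 * Real.sqrt S := by positivity
      linarith
    have h3 : 160 * R ≤ V := by
      have := mul_le_mul_of_nonneg_left (two_le_log hn9) (by positivity : 0 ≤ 1536 * R)
      linarith
    have h4 := pow_le_pow_left₀ (by positivity) (h3.trans h1) 2
    rw [mul_pow, Real.sq_sqrt hn'.le] at h4
    linarith
  obtain ⟨hTpos, hTq, α, hα, hα1, hq⟩ := hT A X hX hr
  obtain ⟨jx, j, b, c, hjx, hγ'0, hγ', hb0, hdesc, hbc, hc⟩ := net.exists_description hn9 normA normW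
    hG0 hpatch hout hLip M a ha0 had r hr happ hOm hl₀ hmax hLn hW A hX hγ hTpos α hα hα1 hq hTq
    hsize hRn
  refine ⟨_, _, b, net.isOpen_lowMargin ρ hG _ _ _ _, net.isOpen_highMargin ρ hG _ _ _ _, hb0, hdesc,
    ?_⟩
  have hsub : μ.real (net.errorSet A) ≤
      μ.real (net.lowMargin (normA 0) A (2 ^ jx) (2 ^ j * (128 * r l₀) / 5)) := by
    refine measureReal_mono ?_
    rintro ⟨x, y⟩ ⟨k, hk, hle⟩
    refine Or.inr ⟨k, hk, ?_⟩
    have : 0 < 2 ^ j * (128 * r l₀) / 5 := by positivity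
    dsimp only at hle ⊢
    linarith
  have hcount : cnt ≤ ∑ k, (net.highMargin (normA 0) A (2 ^ jx) (2 ^ j * (128 * r l₀))).indicator
      (fun _ => (1 : ℝ)) (s k) := by
    have e1 : cnt = ∑ k, if γ < net.margin A (s k).1 (s k).2 then (1 : ℝ) else 0 := by
      rw [hcnt, Nat.card_eq_fintype_card, Fintype.card_subtype, Finset.card_filter]
      push_cast
      rfl
    rw [e1]
    refine Finset.sum_le_sum fun k _ => ?_
    split_ifs with h
    · rw [Set.indicator_of_mem]
      exact ⟨(hxX k).trans_lt hjx, fun c hc =>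
        hγ'.trans_lt (net.lt_score_sub_of_lt_margin A _ _ h c hc)⟩
    · exact Set.indicator_nonneg (fun _ _ => zero_le_one) _
  have hdev : n * deviation n δ b + Real.sqrt n / 2 ≤ Real.sqrt n * B := by
    have h1 := sqrt_cost_le hbc hc hV0 (by linarith) hS0 hℓ2
    have h2 : n * deviation n δ b = Real.sqrt n * Real.sqrt (2 * (b + ℓ)) := by
      rw [deviation, Real.sqrt_div' _ hn'.le, mul_div_left_comm, Real.div_sqrt, mul_comm]
    rw [h2]
    have := mul_le_mul_of_nonneg_left h1 hsn.le
    linarith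
  have := mul_le_mul_of_nonneg_left hsub hn'.le
  linarith

end ConvNet

namespace ConvNet

variable (net : ConvNet)

/-! ### The two capacities -/

theorem capTerm_nonneg (normW : ∀ l, Seminorm ℝ (net.Wt l)) (a : ∀ l, net.Wt l → ℝ)
    (ha0 : ∀ l A, 0 ≤ a l A) (r : ℕ → ℝ) (hr0 : ∀ l, 0 ≤ r l) (A : ∀ l, net.Wt l) {X : ℝ}
    (hX : 0 ≤ X) (l : ℕ) : 0 ≤ net.capTerm normW a r A X l := by
  have h1 := ha0 l (A l)
  have h2 := hr0 l
  have h3 := net.prodExcept_pos normW A l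
  unfold capTerm
  positivity

theorem capTerm_pos (normW : ∀ l, Seminorm ℝ (net.Wt l)) (a : ∀ l, net.Wt l → ℝ)
    (ha0 : ∀ l A, 0 ≤ a l A) (r : ℕ → ℝ) (A : ∀ l, net.Wt l) {X : ℝ}
    (hX : 0 ≤ X) {l : ℕ} (hr : 0 < r l) : 0 < net.capTerm normW a r A X l := by
  have hL := net.one_le_L
  have h1 := ha0 l (A l)
  have h3 := net.prodExcept_pos normW A l
  unfold capTerm
  positivity

end ConvNet

theorem sqrt_sum_sq_le_sum {L : ℕ} (q : ℕ → ℝ) (hq : ∀ l, 0 ≤ q l) :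
    Real.sqrt (∑ l ∈ Finset.range L, q l ^ 2) ≤ ∑ l ∈ Finset.range L, q l :=
  Real.sqrt_le_iff.2 ⟨Finset.sum_nonneg fun l _ => hq l,
    Finset.sum_sq_le_sq_sum_of_nonneg fun l _ => hq l⟩

/-- Optimal allocation of the accuracy for the `2/3`-norm capacity. -/
theorem exists_allocation {L : ℕ} (hL : 1 ≤ L) (q : ℕ → ℝ) (hq0 : ∀ l, 0 ≤ q l)
    (hq : ∀ l < L, 0 < q l) :
    let T := (∑ l ∈ Finset.range L, q l ^ ((2 : ℝ) / 3)) ^ ((3 : ℝ) / 2)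
    0 < T ∧ T ≤ L ^ 2 * ∑ l ∈ Finset.range L, q l ∧
      ∃ α : ℕ → ℝ, (∀ l < L, 0 < α l) ∧ ∑ l ∈ Finset.range L, α l ≤ 1 ∧
        ∑ l ∈ Finset.range L, (q l / α l) ^ 2 ≤ T ^ 2 := by
  intro T
  have hL' : (1 : ℝ) ≤ L := by exact_mod_cast hL
  set Z := ∑ l ∈ Finset.range L, q l ^ ((2 : ℝ) / 3) with hZ
  have hZ0 : 0 < Z := Finset.sum_pos (fun l hl => Real.rpow_pos_of_pos (hq l (Finset.mem_range.1 hl)) _)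
    ⟨0, Finset.mem_range.2 (by omega)⟩
  refine ⟨Real.rpow_pos_of_pos hZ0 _, ?_, fun l => q l ^ ((2 : ℝ) / 3) / Z,
    fun l hl => div_pos (Real.rpow_pos_of_pos (hq l hl) _) hZ0, ?_, ?_⟩
  · set Q := ∑ l ∈ Finset.range L, q l with hQ
    have hQ0 : 0 ≤ Q := Finset.sum_nonneg fun l _ => hq0 l
    have h1 : Z ≤ L * Q ^ ((2 : ℝ) / 3) := by
      rw [← nsmul_eq_mul, ← Finset.card_range L, ← Finset.sum_const]
      refine Finset.sum_le_sum fun l hl => Real.rpow_le_rpow (hq0 l) ?_ (by norm_num)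
      exact Finset.single_le_sum (fun i _ => hq0 i) hl
    calc T ≤ (L * Q ^ ((2 : ℝ) / 3)) ^ ((3 : ℝ) / 2) :=
          Real.rpow_le_rpow hZ0.le h1 (by norm_num)
      _ = (L : ℝ) ^ ((3 : ℝ) / 2) * Q := by
          rw [Real.mul_rpow (by positivity) (by positivity), ← Real.rpow_mul hQ0]
          norm_num
      _ ≤ (L : ℝ) ^ 2 * Q := by
          refine mul_le_mul_of_nonneg_right ?_ hQ0
          rw [← Real.rpow_natCast]
          exact Real.rpow_le_rpow_of_exponent_le hL' (by norm_num)
  · rw [← Finset.sum_div, div_self hZ0.ne']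
  · have hT2 : T ^ 2 = Z ^ 2 * Z := by
      change (Z ^ ((3 : ℝ) / 2)) ^ 2 = _
      rw [← Real.rpow_natCast, ← Real.rpow_mul hZ0.le]
      norm_num
      ring
    rw [hT2]
    conv_rhs => rw [hZ, Finset.mul_sum]
    refine le_of_eq (Finset.sum_congr rfl fun l hl => ?_)
    have hql := hq l (Finset.mem_range.1 hl)
    have h3 : (q l ^ ((2 : ℝ) / 3)) ^ 3 = q l ^ 2 := by
      rw [← Real.rpow_natCast, ← Real.rpow_mul hql.le]
      norm_num
    have hp : 0 < q l ^ ((2 : ℝ) / 3) := Real.rpow_pos_of_pos hql _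
    rw [div_div_eq_mul_div, div_pow, mul_pow, ← h3]
    field_simp
    rfl

/-- Post-hoc margin bound for convolutional networks in terms of abstract layer norms.
Layers are indexed from `0`: the weight `A l` and the nonlinearity `net.G l` lead from layer `l`
to layer `l + 1`, and `ρ`, `k`, `κ` are indexed by the layer they lead to. -/
theorem conv_generalisation_abstract_norms
    (net : ConvNet) (hK : 2 ≤ net.K) (n : ℕ) (hn : 0 < n)
    -- the nonlinearities are `ρ`-Lipschitz for the `ℓ^∞` norms and vanish at `0`
    (ρ : ℕ → ℝ≥0)
    (hG : ∀ l < net.L, LipschitzWith (ρ (l + 1)) (net.G l))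
    (hG0 : ∀ l < net.L, net.G l 0 = 0)
    -- the norms on the activation spaces and on the weight spaces
    (normA : ∀ l, Seminorm ℝ (net.Act l))
    (normW : ∀ l, Seminorm ℝ (net.Wt l))
    (hpatch : ∀ l < net.L, ∀ x : net.Act l, net.patchNorm l x ≤ normA l x)
    (hout : ∀ x : net.Act net.L, ‖x‖ ≤ normA net.L x)
    (hLip : ∀ l < net.L, ∀ (A : net.Wt l) (x y : net.Act l),
      normA (l + 1) (net.layer l A x - net.layer l A y) ≤ normW l A * normA l (x - y))
    -- the data distribution and the reference matrices
    (μ : Measure (net.Act 0 × Fin net.K)) [IsProbabilityMeasure μ]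
    (M : ∀ l, net.Wt l)
    (δ : ℝ) (hδ : 0 < δ) :
    -- the bound with Frobenius norms
    (∀ k : ℕ → ℝ,
      (∀ l < net.L, ∀ x : net.Act (l + 1), normA (l + 1) x ≤ Real.sqrt (k (l + 1)) * ‖x‖) →
      (Measure.pi fun _ : Fin n => μ)
        {s | ∀ (A : ∀ l, net.Wt l) (γ : ℝ), 0 < γ →
          μ.real (net.errorSet A) ≤
            net.riskBound normA normW M s A γ δ (net.capFr normA normW ρ k M s A γ)}ᶜ ≤
        ENNReal.ofReal δ) ∧
    -- the bound with `(2,1)` norms, when the nonlinearities are also Lipschitz for the pixel norms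
    (∀ κ : ℕ → ℝ,
      (∀ l < net.L, ∀ z z' : net.PreAct l,
        pixelNorm (net.G l z - net.G l z') ≤ ρ (l + 1) * pixelNorm (z - z')) →
      (∀ l < net.L, ∀ x : net.Act (l + 1),
        normA (l + 1) x ≤ Real.sqrt (κ (l + 1)) * pixelNorm x) →
      (Measure.pi fun _ : Fin n => μ)
        {s | ∀ (A : ∀ l, net.Wt l) (γ : ℝ), 0 < γ →
          μ.real (net.errorSet A) ≤
            net.riskBound normA normW M s A γ δ (net.cap21 normA normW ρ κ M s A γ)}ᶜ ≤
        ENNReal.ofReal δ) := by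
  have hL := net.one_le_L
  refine ⟨fun k hk => ?_, fun κ hGp hκ => ?_⟩
  · set r : ℕ → ℝ := fun l => ρ (l + 1) * Real.sqrt (k (l + 1)) with hr
    have hr0 : ∀ l, 0 ≤ r l := fun l => mul_nonneg (ρ (l + 1)).2 (Real.sqrt_nonneg _)
    set a : ∀ l, net.Wt l → ℝ := fun l A => net.distFr l A (M l) with ha
    have ha0 : ∀ l A, 0 ≤ a l A := fun l A => net.distFr_nonneg l A (M l)
    have hq0 := fun A X hX l => net.capTerm_nonneg normW a ha0 r hr0 A (X := X) hX l
    have main := net.generalisation_of_capacity hK n hn ρ hG hG0 normA normW hpatch hout hLip μ M δ hδ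
      a ha0 (fun l A => net.distFr_le_dist21 l A (M l)) r hr0
      (fun l hl h A x => by
        refine le_antisymm ?_ (apply_nonneg _ _)
        have h1 := (hG l hl).dist_le_mul (net.conv l A x) 0
        rw [hG0 l hl, dist_zero_right, dist_zero_right] at h1
        calc normA (l + 1) (net.layer l A x)
            ≤ Real.sqrt (k (l + 1)) * ‖net.layer l A x‖ := hk l hl _
          _ ≤ Real.sqrt (k (l + 1)) * (ρ (l + 1) * ‖net.conv l A x‖) :=
              mul_le_mul_of_nonneg_left h1 (Real.sqrt_nonneg _)
          _ = r l * ‖net.conv l A x‖ := by rw [hr]; ring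
          _ = 0 := by rw [h, zero_mul])
      (fun l hl => net.layerApprox_distFr hn l normA (M l) (ρ (l + 1)) (hG l hl) _ (hk l hl))
      (fun A X => net.L * Real.sqrt (∑ l ∈ Finset.range net.L, net.capTerm normW a r A X l ^ 2))
      (fun A X _ => by positivity)
      (fun A X hX hrp => by
        refine ⟨mul_pos (by positivity) (Real.sqrt_pos.2 (Finset.sum_pos (fun l hl => ?_)
          ⟨0, Finset.mem_range.2 net.L_pos⟩)), ?_, fun _ => 1 / net.L, fun l _ => by positivity,
          ?_, ?_⟩
        · exact pow_pos (net.capTerm_pos normW a ha0 r A hX (hrp l (Finset.mem_range.1 hl))) 2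
        · refine mul_le_mul (by nlinarith) (sqrt_sum_sq_le_sum _ (hq0 A X hX)) (Real.sqrt_nonneg _)
            (by positivity)
        · rw [Finset.sum_const, Finset.card_range, nsmul_eq_mul]
          refine le_of_eq ?_; field_simp
        · rw [mul_pow, Real.sq_sqrt (Finset.sum_nonneg fun _ _ => sq_nonneg _), Finset.mul_sum]
          refine le_of_eq (Finset.sum_congr rfl fun l _ => ?_)
          rw [div_div_eq_mul_div, div_one]; ring)
    have hcap : ∀ s (A : ∀ l, net.Wt l) (γ : ℝ), net.capFr normA normW ρ k M s A γ =
        net.L * Real.sqrt (∑ l ∈ Finset.range net.L,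
          net.capTerm normW a r A (net.sampleNorm (n := n) normA s) l ^ 2) / γ := by
      intro s A γ
      have hX : 0 ≤ net.sampleNorm normA s := Real.iSup_nonneg fun _ => apply_nonneg _ _
      have h1 : ∑ l ∈ Finset.range net.L, net.capTerm normW a r A (net.sampleNorm normA s) l ^ 2 =
          (net.sampleNorm normA s + 1) ^ 2 * ∑ l ∈ Finset.range net.L,
            ((net.distFr l (A l) (M l) + 1 / (net.L : ℝ)) *
              (ρ (l + 1) * Real.sqrt (k (l + 1))) * net.prodExcept normW A l) ^ 2 := by
        rw [Finset.mul_sum]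
        exact Finset.sum_congr rfl fun l _ => by rw [ConvNet.capTerm, mul_pow]
      rw [h1, Real.sqrt_mul (by positivity), Real.sqrt_sq (by linarith), ConvNet.capFr]
      ring
    simp only [hcap]
    exact main
  · set r : ℕ → ℝ := fun l => ρ (l + 1) * Real.sqrt (κ (l + 1)) with hr
    have hr0 : ∀ l, 0 ≤ r l := fun l => mul_nonneg (ρ (l + 1)).2 (Real.sqrt_nonneg _)
    set a : ∀ l, net.Wt l → ℝ := fun l A => net.dist21 l A (M l) with ha
    have ha0 : ∀ l A, 0 ≤ a l A := fun l A => net.dist21_nonneg l A (M l)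
    have hq0 := fun A X hX l => net.capTerm_nonneg normW a ha0 r hr0 A (X := X) hX l
    have main := net.generalisation_of_capacity hK n hn ρ hG hG0 normA normW hpatch hout hLip μ M δ hδ
      a ha0 (fun l A => le_rfl) r hr0
      (fun l hl h A x => by
        refine le_antisymm ?_ (apply_nonneg _ _)
        have h1 := hGp l hl (net.conv l A x) 0
        rw [hG0 l hl, sub_zero, sub_zero] at h1
        calc normA (l + 1) (net.layer l A x)
            ≤ Real.sqrt (κ (l + 1)) * pixelNorm (net.layer l A x) := hκ l hl _
          _ ≤ Real.sqrt (κ (l + 1)) * (ρ (l + 1) * pixelNorm (net.conv l A x)) :=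
              mul_le_mul_of_nonneg_left h1 (Real.sqrt_nonneg _)
          _ = r l * pixelNorm (net.conv l A x) := by rw [hr]; ring
          _ = 0 := by rw [h, zero_mul])
      (fun l hl => net.layerApprox_dist21 l normA (M l) (ρ (l + 1)) (hGp l hl) _ (hκ l hl))
      (fun A X => (∑ l ∈ Finset.range net.L,
        net.capTerm normW a r A X l ^ ((2 : ℝ) / 3)) ^ ((3 : ℝ) / 2))
      (fun A X hX => Real.rpow_nonneg (Finset.sum_nonneg fun l _ =>
        Real.rpow_nonneg (hq0 A X hX l) _) _)
      (fun A X hX hrp => exists_allocation net.L_pos _ (hq0 A X hX) fun l hl =>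
        net.capTerm_pos normW a ha0 r A hX (hrp l hl))
    have hcap : ∀ s (A : ∀ l, net.Wt l) (γ : ℝ), net.cap21 normA normW ρ κ M s A γ =
        (∑ l ∈ Finset.range net.L,
          net.capTerm normW a r A (net.sampleNorm (n := n) normA s) l ^ ((2 : ℝ) / 3)) ^
            ((3 : ℝ) / 2) / γ := by
      intro s A γ
      have hX : 0 ≤ net.sampleNorm normA s := Real.iSup_nonneg fun _ => apply_nonneg _ _
      have ht : ∀ l, 0 ≤ (net.dist21 l (A l) (M l) + 1 / (net.L : ℝ)) *
          (ρ (l + 1) * Real.sqrt (κ (l + 1))) * net.prodExcept normW A l := fun l => by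
        have h1 := net.dist21_nonneg l (A l) (M l)
        have h2 := net.prodExcept_pos normW A l
        positivity
      have h1 : ∑ l ∈ Finset.range net.L,
            net.capTerm normW a r A (net.sampleNorm normA s) l ^ ((2 : ℝ) / 3) =
          (net.sampleNorm normA s + 1) ^ ((2 : ℝ) / 3) * ∑ l ∈ Finset.range net.L,
            ((net.dist21 l (A l) (M l) + 1 / (net.L : ℝ)) *
              (ρ (l + 1) * Real.sqrt (κ (l + 1))) * net.prodExcept normW A l) ^ ((2 : ℝ) / 3) := by
        rw [Finset.mul_sum]
        exact Finset.sum_congr rfl fun l _ => by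
          rw [ConvNet.capTerm, Real.mul_rpow (by linarith) (ht l)]
      rw [h1, Real.mul_rpow (by positivity) (Finset.sum_nonneg fun l _ => Real.rpow_nonneg (ht l) _),
        ← Real.rpow_mul (by linarith), ConvNet.cap21]
      norm_num
      ring
    simp only [hcap]
    exact main
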